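/- arXiv:1301.4313 — 4 statements merged into one kernel-verified Lean document; each statement's English description precedes it below -/
import Mathlib

section
/- Let k be a field of characteristic zero, let n ≥ 1, let f ∈ k[t][x_0,…,x_n] be homogeneous in x_0,…,x_n of degree d ≥ 2, let ℓ ≥ 1, and let a ∈ k[t][x_0,…,x_n] be homogeneous in x_0,…,x_n of degree ℓ·d − (n+1). Assume that, over k(t), the quotient k(t)[x_0,…,x_n]/Jac f is finite-dimensional over k(t). Then a/f^ℓ admits a telescoper with regular certificate of some order r ≤ d^n whose coefficients c_0,…,c_r ∈ k[t] (not all zero) satisfy, for every i, deg_t c_i ≤ r·deg_t a + (r² + r·ℓ)·eⁿ·dⁿ·deg_t f, where e is Euler's number and the inequality holds in ℝ. -/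
open MvPolynomial

/-- The derivation `∂_t` on polynomials in `x₀,…` with coefficients in `R[t]`,
acting coefficientwise by `d/dt`. -/
noncomputable def dtMv {R : Type*} [CommRing R] {σ : Type*}
    (P : MvPolynomial σ (Polynomial R)) : MvPolynomial σ (Polynomial R) :=
  ∑ m ∈ P.support, monomial m (Polynomial.derivative (P.coeff m))

/-- The sequence of numerators `P_j` with `∂_t^j(a/f^ℓ) = P_j/f^{ℓ+j}`:
`P_0 = a` and `P_{j+1} = f·∂_t P_j − (ℓ+j)·P_j·∂_t f`. -/
noncomputable def telSeq {A : Type*} [CommRing A] (D : A → A) (f a : A) (ℓ : ℕ) :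
    ℕ → A
  | 0 => a
  | j + 1 => f * D (telSeq D f a ℓ j)
      - ((ℓ + j : ℕ) : A) * telSeq D f a ℓ j * D f

/-- The degree in `t` of a polynomial in `x₀,…` with coefficients in `k[t]`. -/
noncomputable def degT {R : Type*} [CommRing R] {σ : Type*}
    (a : MvPolynomial σ (Polynomial R)) : ℕ :=
  a.support.sup fun m => (a.coeff m).natDegree

section GradedIdeals

variable {σ K : Type*} [Field K]

/-- An ideal of a polynomial ring that contains the homogeneous components of its elements. -/
def IsGradedIdeal (I : Ideal (MvPolynomial σ K)) : Prop :=
  ∀ p ∈ I, ∀ s, homogeneousComponent s p ∈ I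

/-- `c` is a nonzerodivisor modulo `I`. -/
def RegularMod (c : MvPolynomial σ K) (I : Ideal (MvPolynomial σ K)) : Prop :=
  ∀ p, c * p ∈ I → p ∈ I

lemma isGradedIdeal_span {S : Set (MvPolynomial σ K)} {e : ℕ}
    (hS : ∀ p ∈ S, p.IsHomogeneous e) : IsGradedIdeal (Ideal.span S) := by
  intro p hp s
  let := MvPolynomial.gradedAlgebra (σ := σ) (R := K)
  refine homogeneousComponent_mem_of_mem (Ideal.homogeneous_span _ _ ?_) hp s
  exact fun x hx => ⟨e, hS x hx⟩

lemma homogeneousComponent_add_mul {c : MvPolynomial σ K} {e : ℕ} (hc : c.IsHomogeneous e)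
    (s : ℕ) (p : MvPolynomial σ K) :
    homogeneousComponent (e + s) (c * p) = c * homogeneousComponent s p := by
  induction p using MvPolynomial.induction_on' with
  | monomial d x =>
    have h := isHomogeneous_monomial (σ := σ) x (d := d) rfl
    rw [homogeneousComponent_of_mem h, homogeneousComponent_of_mem (hc.mul h)]
    by_cases hs : s = d.degree <;> simp [hs]
  | add p q hp hq => simp [mul_add, hp, hq]

lemma homogeneousComponent_mul_of_lt {c : MvPolynomial σ K} {e : ℕ} (hc : c.IsHomogeneous e)
    {s : ℕ} (hs : s < e) (p : MvPolynomial σ K) :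
    homogeneousComponent s (c * p) = 0 := by
  induction p using MvPolynomial.induction_on' with
  | monomial d x =>
    have h := isHomogeneous_monomial (σ := σ) x (d := d) rfl
    rw [homogeneousComponent_of_mem (hc.mul h), if_neg (by omega)]
  | add p q hp hq => simp [mul_add, hp, hq]

lemma exists_of_mem_sup_span {I : Ideal (MvPolynomial σ K)} (hI : IsGradedIdeal I)
    {c : MvPolynomial σ K} {e : ℕ} (hc : c.IsHomogeneous e) {s : ℕ} {p : MvPolynomial σ K}
    (hp : p.IsHomogeneous (e + s)) (h : p ∈ I ⊔ Ideal.span {c}) :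
    ∃ u ∈ I, ∃ v, v.IsHomogeneous s ∧ u.IsHomogeneous (e + s) ∧ p = u + c * v := by
  obtain ⟨u, hu, w, hw, rfl⟩ := Submodule.mem_sup.1 h
  obtain ⟨v, rfl⟩ := Ideal.mem_span_singleton'.1 hw
  refine ⟨_, hI u hu (e + s), _, homogeneousComponent_isHomogeneous s v,
    homogeneousComponent_isHomogeneous _ _, ?_⟩
  rw [← homogeneousComponent_eq_self hp, map_add, mul_comm v, homogeneousComponent_add_mul hc]

lemma mem_of_mem_sup_span_of_lt {I : Ideal (MvPolynomial σ K)} (hI : IsGradedIdeal I)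
    {c : MvPolynomial σ K} {e : ℕ} (hc : c.IsHomogeneous e) {s : ℕ} (hs : s < e)
    {p : MvPolynomial σ K} (hp : p.IsHomogeneous s) (h : p ∈ I ⊔ Ideal.span {c}) : p ∈ I := by
  obtain ⟨u, hu, w, hw, rfl⟩ := Submodule.mem_sup.1 h
  obtain ⟨v, rfl⟩ := Ideal.mem_span_singleton'.1 hw
  rw [← homogeneousComponent_eq_self hp, map_add, mul_comm v, homogeneousComponent_mul_of_lt hc hs,
    add_zero]
  exact hI u hu s

lemma mem_of_homogeneousComponent_mem {I : Ideal (MvPolynomial σ K)} {p : MvPolynomial σ K}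
    (h : ∀ s, homogeneousComponent s p ∈ I) : p ∈ I := by
  rw [← sum_homogeneousComponent p]
  exact Ideal.sum_mem _ fun s _ => h s

lemma regularMod_of_isHomogeneous {I : Ideal (MvPolynomial σ K)} (hI : IsGradedIdeal I)
    {c : MvPolynomial σ K} {e : ℕ} (hc : c.IsHomogeneous e)
    (h : ∀ s, ∀ p, p.IsHomogeneous s → c * p ∈ I → p ∈ I) : RegularMod c I := by
  intro p hp
  refine mem_of_homogeneousComponent_mem fun s => h s _ (homogeneousComponent_isHomogeneous s p) ?_
  rw [← homogeneousComponent_add_mul hc]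
  exact hI _ hp _

/-- If `c` is regular modulo `I` and `b` is regular modulo `I + (c)`, then `b` is regular
modulo `I`. -/
lemma RegularMod.of_sup_span {I : Ideal (MvPolynomial σ K)} (hI : IsGradedIdeal I)
    {b c : MvPolynomial σ K} {e : ℕ} (he : 0 < e) (hb : b.IsHomogeneous e)
    (hc : c.IsHomogeneous e) (hcI : RegularMod c I) (hbc : RegularMod b (I ⊔ Ideal.span {c})) :
    RegularMod b I := by
  refine regularMod_of_isHomogeneous hI hb fun s => ?_
  induction s using Nat.strong_induction_on with
  | _ s ih =>
    intro p hp hbp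
    have hpc := hbc p (Ideal.mem_sup_left hbp)
    by_cases hs : s < e
    · exact mem_of_mem_sup_span_of_lt hI hc hs hp hpc
    · obtain ⟨t, rfl⟩ := Nat.exists_eq_add_of_le (not_lt.1 hs)
      obtain ⟨u, hu, v, hv, -, rfl⟩ := exists_of_mem_sup_span hI hc hp hpc
      refine I.add_mem hu (I.mul_mem_left _ (ih t (by omega) v hv (hcI _ ?_)))
      have : c * (b * v) = b * (u + c * v) - b * u := by ring
      rw [this]
      exact I.sub_mem hbp (I.mul_mem_left _ hu)

/-- Regularity of the pair `c`, `b` modulo `I` implies that `c` is regular modulo `I + (b)`. -/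
lemma RegularMod.sup_span_swap {I : Ideal (MvPolynomial σ K)} {b c : MvPolynomial σ K}
    (hcI : RegularMod c I) (hbc : RegularMod b (I ⊔ Ideal.span {c})) :
    RegularMod c (I ⊔ Ideal.span {b}) := by
  intro p hp
  obtain ⟨u, hu, w, hw, h⟩ := Submodule.mem_sup.1 hp
  obtain ⟨v, rfl⟩ := Ideal.mem_span_singleton'.1 hw
  have hv : v ∈ I ⊔ Ideal.span {c} := by
    refine hbc v ?_
    have : b * v = - u + p * c := by linear_combination h
    rw [this]
    exact Submodule.add_mem_sup (I.neg_mem hu) (Ideal.mem_span_singleton'.2 ⟨p, rfl⟩)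
  obtain ⟨u', hu', w', hw', rfl⟩ := Submodule.mem_sup.1 hv
  obtain ⟨v', rfl⟩ := Ideal.mem_span_singleton'.1 hw'
  have h1 : p - v' * b ∈ I := by
    refine hcI _ ?_
    have : c * (p - v' * b) = u + u' * b := by linear_combination -h
    rw [this]
    exact I.add_mem hu (I.mul_mem_right _ hu')
  have : p = (p - v' * b) + v' * b := by ring
  rw [this]
  exact Submodule.add_mem_sup h1 (Ideal.mem_span_singleton'.2 ⟨v', rfl⟩)

/-- The dimension of the degree `s` part of `I`. -/
noncomputable def gradedRank (I : Ideal (MvPolynomial σ K)) (s : ℕ) : ℕ :=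
  Module.finrank K ↥(I.restrictScalars K ⊓ homogeneousSubmodule σ K s)

lemma gradedPart_sup_span {I : Ideal (MvPolynomial σ K)} (hI : IsGradedIdeal I)
    {c : MvPolynomial σ K} {e : ℕ} (hc : c.IsHomogeneous e) (s : ℕ) :
    (I ⊔ Ideal.span {c}).restrictScalars K ⊓ homogeneousSubmodule σ K (e + s) =
      (I.restrictScalars K ⊓ homogeneousSubmodule σ K (e + s)) ⊔
        (homogeneousSubmodule σ K s).map (LinearMap.mulLeft K c) := by
  ext p
  constructor
  · rintro ⟨h1, h2⟩
    obtain ⟨u, hu, v, hv, hu2, rfl⟩ := exists_of_mem_sup_span hI hc h2 h1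
    exact Submodule.add_mem_sup ⟨hu, hu2⟩ ⟨v, hv, rfl⟩
  · intro h
    obtain ⟨u, ⟨hu, hu2⟩, _, ⟨v, hv, rfl⟩, rfl⟩ := Submodule.mem_sup.1 h
    refine ⟨?_, IsHomogeneous.add hu2 (hc.mul hv)⟩
    exact Submodule.add_mem_sup hu (Ideal.mem_span_singleton'.2 ⟨v, mul_comm _ _⟩)

lemma finrank_map_mulLeft {c : MvPolynomial σ K} (hc : c ≠ 0)
    (V : Submodule K (MvPolynomial σ K)) :
    Module.finrank K (V.map (LinearMap.mulLeft K c)) = Module.finrank K V :=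
  (LinearEquiv.finrank_eq (Submodule.equivMapOfInjective (LinearMap.mulLeft K c)
    (mul_right_injective₀ hc) V)).symm

lemma gradedRank_sup_span_of_lt {I : Ideal (MvPolynomial σ K)} (hI : IsGradedIdeal I)
    {c : MvPolynomial σ K} {e : ℕ} (hc : c.IsHomogeneous e) {s : ℕ} (hs : s < e) :
    gradedRank (I ⊔ Ideal.span {c}) s = gradedRank I s := by
  have : (I ⊔ Ideal.span {c}).restrictScalars K ⊓ homogeneousSubmodule σ K s =
      I.restrictScalars K ⊓ homogeneousSubmodule σ K s := by
    ext p
    constructor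
    · rintro ⟨h1, h2⟩
      exact ⟨mem_of_mem_sup_span_of_lt hI hc hs h2 h1, h2⟩
    · rintro ⟨h1, h2⟩
      exact ⟨Ideal.mem_sup_left h1, h2⟩
  rw [gradedRank, this, gradedRank]

/-- The ideal contains all forms of some degree. -/
def ContainsForms (I : Ideal (MvPolynomial σ K)) (s : ℕ) : Prop :=
  ∀ p : MvPolynomial σ K, p.IsHomogeneous s → p ∈ I

lemma gradedRank_eq_of_containsForms {I : Ideal (MvPolynomial σ K)} {s : ℕ}
    (h : ContainsForms I s) :
    gradedRank I s = Module.finrank K (homogeneousSubmodule σ K s) := by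
  rw [gradedRank, inf_eq_right.2 (fun p hp => h p hp)]

lemma monomial_mem_of_containsForms {I : Ideal (MvPolynomial σ K)} {s : ℕ}
    (h : ContainsForms I s) {d : σ →₀ ℕ} (hd : s ≤ d.degree) (x : K) : monomial d x ∈ I := by
  obtain ⟨d', hd', hs⟩ : ∃ d' ≤ d, d'.degree = s := Finsupp.exists_le_degree_eq d s hd
  obtain ⟨d'', rfl⟩ := exists_add_of_le hd'
  rw [← mul_one x, ← monomial_mul]
  exact I.mul_mem_right _ (h _ (isHomogeneous_monomial x hs))

lemma ContainsForms.mono {I : Ideal (MvPolynomial σ K)} {s t : ℕ}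
    (h : ContainsForms I s) (hst : s ≤ t) : ContainsForms I t := by
  intro p hp
  rw [p.as_sum]
  refine Ideal.sum_mem _ fun d hd => monomial_mem_of_containsForms h ?_ _
  rw [hp.degree_eq_sum_deg_support hd] at hst
  exact hst

/-- A family of polynomials that is a regular sequence in every order. -/
def RegularFamily {ι : Type*} (z : ι → MvPolynomial σ K) : Prop :=
  ∀ (T : Finset ι) (i : ι), i ∉ T → RegularMod (z i) (Ideal.span (z '' T))

lemma RegularFamily.ne_zero {ι : Type*} {z : ι → MvPolynomial σ K} (h : RegularFamily z) (i : ι) :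
    z i ≠ 0 := by
  intro h0
  have := h ∅ i (by simp) 1 (by simp [h0])
  simp at this

lemma span_image_insert {ι : Type*} [DecidableEq ι] (z : ι → MvPolynomial σ K) (T : Finset ι)
    (i : ι) : Ideal.span (z '' ↑(insert i T)) = Ideal.span (z '' T) ⊔ Ideal.span {z i} := by
  rw [Finset.coe_insert, Set.image_insert_eq, Ideal.span_insert, sup_comm]

lemma span_range_eq_sup {ι : Type*} [Fintype ι] [DecidableEq ι] (z : ι → MvPolynomial σ K)
    (i : ι) : Ideal.span (Set.range z) =
      Ideal.span (z '' ↑(Finset.univ.erase i)) ⊔ Ideal.span {z i} := by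
  rw [← span_image_insert, Finset.insert_erase (Finset.mem_univ i), Finset.coe_univ,
    Set.image_univ]

lemma update_image_of_notMem {ι : Type*} [DecidableEq ι] (z : ι → MvPolynomial σ K) {T : Finset ι}
    {i : ι} (hi : i ∉ T) (b : MvPolynomial σ K) : Function.update z i b '' T = z '' T := by
  refine Set.image_congr fun j hj => Function.update_of_ne ?_ _ _
  rintro rfl
  exact hi hj

lemma isGradedIdeal_span_image {ι : Type*} {z : ι → MvPolynomial σ K} {e : ℕ}
    (hz : ∀ j, (z j).IsHomogeneous e) (T : Set ι) : IsGradedIdeal (Ideal.span (z '' T)) := by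
  refine isGradedIdeal_span (e := e) ?_
  rintro _ ⟨j, -, rfl⟩
  exact hz j

lemma isHomogeneous_piecewise {ι : Type*} [DecidableEq ι] {u v : ι → MvPolynomial σ K} {e : ℕ}
    (hu : ∀ j, (u j).IsHomogeneous e) (hv : ∀ j, (v j).IsHomogeneous e) (S : Finset ι) (j : ι) :
    (S.piecewise v u j).IsHomogeneous e := by
  by_cases hj : j ∈ S <;> simp [hj, hu, hv]

lemma exists_isHomogeneous_of_mem_span_range {ι : Type*} [Fintype ι] {z : ι → MvPolynomial σ K}
    {e : ℕ} (hz : ∀ j, (z j).IsHomogeneous e) {s : ℕ} {p : MvPolynomial σ K}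
    (hp : p.IsHomogeneous (e + s)) (h : p ∈ Ideal.span (Set.range z)) :
    ∃ B : ι → MvPolynomial σ K, (∀ i, (B i).IsHomogeneous s) ∧ ∑ i, B i * z i = p := by
  obtain ⟨B, hB⟩ := Ideal.mem_span_range_iff_exists_fun.1 h
  refine ⟨fun i => homogeneousComponent s (B i), fun i => homogeneousComponent_isHomogeneous s _,
    ?_⟩
  rw [← homogeneousComponent_eq_self hp, ← hB, map_sum]
  exact Finset.sum_congr rfl fun i _ => by
    rw [mul_comm, mul_comm (B i), homogeneousComponent_add_mul (hz i)]

lemma eq_zero_of_mem_span_range_of_lt {ι : Type*} [Fintype ι] {z : ι → MvPolynomial σ K}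
    {e : ℕ} (hz : ∀ j, (z j).IsHomogeneous e) {s : ℕ} (hs : s < e) {p : MvPolynomial σ K}
    (hp : p.IsHomogeneous s) (h : p ∈ Ideal.span (Set.range z)) : p = 0 := by
  obtain ⟨B, hB⟩ := Ideal.mem_span_range_iff_exists_fun.1 h
  rw [← homogeneousComponent_eq_self hp, ← hB, map_sum]
  exact Finset.sum_eq_zero fun i _ => by
    rw [mul_comm, homogeneousComponent_mul_of_lt (hz i) hs]

variable [Finite σ]

instance (s : ℕ) : FiniteDimensional K (homogeneousSubmodule σ K s) :=
  Module.Finite.iff_fg.2 (homogeneousSubmodule_fg σ K s)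

instance (I : Ideal (MvPolynomial σ K)) (s : ℕ) :
    FiniteDimensional K ↥(I.restrictScalars K ⊓ homogeneousSubmodule σ K s) :=
  Submodule.finiteDimensional_of_le inf_le_right

lemma gradedRank_sup_span {I : Ideal (MvPolynomial σ K)} (hI : IsGradedIdeal I)
    {c : MvPolynomial σ K} {e : ℕ} (hc : c.IsHomogeneous e) (hc0 : c ≠ 0) (hcI : RegularMod c I)
    (s : ℕ) :
    gradedRank (I ⊔ Ideal.span {c}) (e + s) + gradedRank I s =
      gradedRank I (e + s) + Module.finrank K (homogeneousSubmodule σ K s) := by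
  have h := Submodule.finrank_sup_add_finrank_inf_eq
    (I.restrictScalars K ⊓ homogeneousSubmodule σ K (e + s))
    ((homogeneousSubmodule σ K s).map (LinearMap.mulLeft K c))
  rw [← gradedPart_sup_span hI hc, finrank_map_mulLeft hc0] at h
  have h2 : (I.restrictScalars K ⊓ homogeneousSubmodule σ K (e + s)) ⊓
      (homogeneousSubmodule σ K s).map (LinearMap.mulLeft K c) =
      (I.restrictScalars K ⊓ homogeneousSubmodule σ K s).map (LinearMap.mulLeft K c) := by
    ext p
    constructor
    · rintro ⟨⟨h1, -⟩, v, hv, rfl⟩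
      exact ⟨v, ⟨hcI v h1, hv⟩, rfl⟩
    · rintro ⟨v, ⟨hv, hv2⟩, rfl⟩
      exact ⟨⟨I.mul_mem_left c hv, hc.mul hv2⟩, v, hv2, rfl⟩
  rw [h2, finrank_map_mulLeft hc0] at h
  exact h

/-- If `a` is regular modulo `I` and both `I + (a)` and `I + (b)` contain all forms of large
degree, then `b` is regular modulo `I`. -/
lemma RegularMod.exchange {I : Ideal (MvPolynomial σ K)} (hI : IsGradedIdeal I)
    {a b : MvPolynomial σ K} {e : ℕ} (ha : a.IsHomogeneous e) (hb : b.IsHomogeneous e)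
    (ha0 : a ≠ 0) (he : 0 < e)
    (haI : RegularMod a I) {s₀ : ℕ} (h1 : ContainsForms (I ⊔ Ideal.span {a}) s₀)
    (h2 : ContainsForms (I ⊔ Ideal.span {b}) s₀) : RegularMod b I := by
  have key : ∀ s, s₀ ≤ s → ∀ p, p.IsHomogeneous s → b * p ∈ I → p ∈ I := by
    intro s hs p hp hbp
    have e1 := gradedRank_sup_span hI ha ha0 haI s
    rw [gradedRank_eq_of_containsForms (h1.mono (by omega))] at e1
    have h := Submodule.finrank_sup_add_finrank_inf_eq
      (I.restrictScalars K ⊓ homogeneousSubmodule σ K (e + s))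
      ((homogeneousSubmodule σ K s).map (LinearMap.mulLeft K b))
    rw [← gradedPart_sup_span hI hb] at h
    have e2 := gradedRank_eq_of_containsForms (h2.mono (show s₀ ≤ e + s by omega))
    rw [gradedRank] at e2
    rw [e2] at h
    by_cases hb0 : b = 0
    · subst hb0
      have h3 : ContainsForms I s₀ := by simpa using h2
      exact h3.mono hs p hp
    · rw [finrank_map_mulLeft hb0] at h
      have hle : (I.restrictScalars K ⊓ homogeneousSubmodule σ K s).map (LinearMap.mulLeft K b) ≤
          (I.restrictScalars K ⊓ homogeneousSubmodule σ K (e + s)) ⊓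
          (homogeneousSubmodule σ K s).map (LinearMap.mulLeft K b) := by
        rintro _ ⟨v, ⟨hv, hv2⟩, rfl⟩
        exact ⟨⟨I.mul_mem_left b hv, hb.mul hv2⟩, v, hv2, rfl⟩
      have heq := Submodule.eq_of_le_of_finrank_le hle (by
        rw [finrank_map_mulLeft hb0]
        change _ ≤ gradedRank I s
        change _ = gradedRank I (e + s) + _ at h
        omega)
      have hmem : b * p ∈ (I.restrictScalars K ⊓ homogeneousSubmodule σ K (e + s)) ⊓
          (homogeneousSubmodule σ K s).map (LinearMap.mulLeft K b) :=
        ⟨⟨hbp, hb.mul hp⟩, p, hp, rfl⟩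
      rw [← heq] at hmem
      obtain ⟨v, ⟨hv, -⟩, hvp⟩ := hmem
      rwa [mul_left_cancel₀ hb0 (show b * v = b * p from hvp)] at hv
  have pow_reg : ∀ m p, a ^ m * p ∈ I → p ∈ I := by
    intro m
    induction m with
    | zero => intro p hp; simpa using hp
    | succ m ih => intro p hp; exact ih p (haI _ (by rwa [← mul_assoc, ← pow_succ']))
  refine regularMod_of_isHomogeneous hI hb fun s p hp hbp => pow_reg s₀ p ?_
  refine key _ ?_ _ ((ha.pow s₀).mul hp) ?_
  · nlinarith
  · rw [mul_left_comm]
    exact I.mul_mem_left _ hbp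

lemma gradedRank_sup_span_congr {I : Ideal (MvPolynomial σ K)} (hI : IsGradedIdeal I)
    {a b : MvPolynomial σ K} {e : ℕ} (ha : a.IsHomogeneous e) (hb : b.IsHomogeneous e)
    (ha0 : a ≠ 0) (hb0 : b ≠ 0) (haI : RegularMod a I) (hbI : RegularMod b I) (s : ℕ) :
    gradedRank (I ⊔ Ideal.span {a}) s = gradedRank (I ⊔ Ideal.span {b}) s := by
  by_cases hs : s < e
  · rw [gradedRank_sup_span_of_lt hI ha hs, gradedRank_sup_span_of_lt hI hb hs]
  · obtain ⟨t, rfl⟩ := Nat.exists_eq_add_of_le (not_lt.1 hs)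
    have h1 := gradedRank_sup_span hI ha ha0 haI t
    have h2 := gradedRank_sup_span hI hb hb0 hbI t
    omega

/-- Replacing one member of a regular family of forms keeps it regular, and keeps the Hilbert
function, as long as the new family still generates all forms of large degree. -/
lemma RegularFamily.update {ι : Type*} [Fintype ι] [DecidableEq ι] {z : ι → MvPolynomial σ K}
    {e : ℕ} (he : 0 < e) (hz : ∀ j, (z j).IsHomogeneous e) (h : RegularFamily z) (i : ι)
    {b : MvPolynomial σ K} (hb : b.IsHomogeneous e) {s₀ : ℕ}
    (h1 : ContainsForms (Ideal.span (Set.range z)) s₀)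
    (h2 : ContainsForms (Ideal.span (Set.range (Function.update z i b))) s₀) :
    RegularFamily (Function.update z i b) ∧
      ∀ s, gradedRank (Ideal.span (Set.range (Function.update z i b))) s =
        gradedRank (Ideal.span (Set.range z)) s := by
  have claim : ∀ U T : Finset ι, i ∉ T → Finset.univ.erase i ⊆ T ∪ U →
      RegularMod b (Ideal.span (z '' T)) := by
    intro U
    induction U using Finset.induction_on with
    | empty =>
      intro T hi hT
      have hT' : T = Finset.univ.erase i := by
        refine Finset.Subset.antisymm (fun j hj => ?_) (by simpa using hT)
        simp only [Finset.mem_erase, Finset.mem_univ, and_true]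
        rintro rfl
        exact hi hj
      rw [span_range_eq_sup z i, ← hT'] at h1
      rw [span_range_eq_sup _ i, ← hT', update_image_of_notMem z hi, Function.update_self] at h2
      exact (h T i hi).exchange (isGradedIdeal_span_image hz _) (hz i) hb (h.ne_zero i) he h1 h2
    | insert c U _ ih =>
      intro T hi hT
      by_cases hc : c ∈ T ∨ c = i
      · refine ih T hi fun j hj => ?_
        have := hT hj
        have hji := Finset.ne_of_mem_erase hj
        simp only [Finset.mem_union, Finset.mem_insert] at this ⊢
        rcases this with h | rfl | h
        · exact Or.inl h
        · exact Or.inl (hc.resolve_right hji)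
        · exact Or.inr h
      · push Not at hc
        have hreg := ih (insert c T) (by simp [hi, hc.2.symm]) (by
          rwa [Finset.insert_union, ← Finset.union_insert])
        rw [span_image_insert] at hreg
        exact RegularMod.of_sup_span (isGradedIdeal_span_image hz _) he hb (hz c) (h T c hc.1) hreg
  have claim' : ∀ T : Finset ι, i ∉ T → RegularMod b (Ideal.span (z '' T)) := fun T hi =>
    claim Finset.univ T hi fun j _ => Finset.mem_union_right _ (Finset.mem_univ j)
  have hreg : RegularFamily (Function.update z i b) := by
    intro T j hj
    by_cases hji : j = i
    · subst hji
      rw [update_image_of_notMem z hj, Function.update_self]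
      exact claim' T hj
    · rw [Function.update_of_ne hji]
      by_cases hi : i ∈ T
      · have hT0 : i ∉ T.erase i := Finset.notMem_erase i T
        rw [← Finset.insert_erase hi, span_image_insert, Function.update_self,
          update_image_of_notMem z hT0]
        refine RegularMod.sup_span_swap (h _ _ fun hj' => hj (Finset.mem_of_mem_erase hj')) ?_
        rw [← span_image_insert]
        exact claim' _ (by simp [Ne.symm hji])
      · rw [update_image_of_notMem z hi]
        exact h T j hj
  refine ⟨hreg, fun s => ?_⟩
  have hb0 := hreg.ne_zero i
  rw [Function.update_self] at hb0
  rw [span_range_eq_sup z i, span_range_eq_sup _ i,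
    update_image_of_notMem z (Finset.notMem_erase i _), Function.update_self]
  exact gradedRank_sup_span_congr (isGradedIdeal_span_image hz _) hb (hz i) hb0 (h.ne_zero i)
    (claim' _ (Finset.notMem_erase i _)) (h _ _ (Finset.notMem_erase i _)) s

lemma RegularFamily.of_piecewise {ι : Type*} [Fintype ι] [DecidableEq ι]
    {u v : ι → MvPolynomial σ K} {e : ℕ} (he : 0 < e) (hu : ∀ j, (u j).IsHomogeneous e)
    (hv : ∀ j, (v j).IsHomogeneous e) {s₀ : ℕ}
    (hS : ∀ S : Finset ι, ContainsForms (Ideal.span (Set.range (S.piecewise v u))) s₀)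
    (h : RegularFamily u) :
    RegularFamily v ∧ ∀ s, gradedRank (Ideal.span (Set.range v)) s =
        gradedRank (Ideal.span (Set.range u)) s := by
  have key : ∀ S : Finset ι, RegularFamily (S.piecewise v u) ∧
      ∀ s, gradedRank (Ideal.span (Set.range (S.piecewise v u))) s =
        gradedRank (Ideal.span (Set.range u)) s := by
    intro S
    induction S using Finset.induction_on with
    | empty => simpa using h
    | insert i S _ ih =>
      have h2 := hS (insert i S)
      rw [Finset.piecewise_insert] at h2 ⊢
      obtain ⟨h3, h4⟩ := ih.1.update he (isHomogeneous_piecewise hu hv S) i (hv i) (hS S) h2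
      exact ⟨h3, fun s => (h4 s).trans (ih.2 s)⟩
  simpa using key Finset.univ

/-- Generating all forms of a given degree is an open condition on lines of families of forms. -/
lemma finite_not_containsForms_add_smul {ι : Type*} [Fintype ι] {u v : ι → MvPolynomial σ K}
    {e s : ℕ} (hu : ∀ j, (u j).IsHomogeneous e) (hv : ∀ j, (v j).IsHomogeneous e)
    (h : ContainsForms (Ideal.span (Set.range u)) (e + s)) :
    {x : K | ¬ ContainsForms (Ideal.span (Set.range (u + x • v))) (e + s)}.Finite := by
  classical
  set V := homogeneousSubmodule σ K (e + s) with hV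
  let b := Module.finBasis K V
  have hex : ∀ i, ∃ B : ι → MvPolynomial σ K, (∀ j, (B j).IsHomogeneous s) ∧
      ∑ j, B j * u j = (b i : MvPolynomial σ K) := fun i =>
    exists_isHomogeneous_of_mem_span_range hu (b i).2 (h _ (b i).2)
  choose B hB hBu using hex
  have hN : ∀ i, ∑ j, B i j * v j ∈ V := fun i => by
    refine Submodule.sum_mem _ fun j _ => ?_
    rw [hV, mem_homogeneousSubmodule, add_comm]
    exact (hB i j).mul (hv j)
  let N : Module.End K V := b.constr K fun i => ⟨∑ j, B i j * v j, hN i⟩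
  have hmem : ∀ (x : K) (p : V), ((p + x • N p : V) : MvPolynomial σ K) ∈
      Ideal.span (Set.range (u + x • v)) := by
    intro x p
    have hle : (⊤ : Submodule K V) ≤
        ((Ideal.span (Set.range (u + x • v))).restrictScalars K).comap
          (V.subtype ∘ₗ (LinearMap.id + x • N)) := by
      rw [← b.span_eq, Submodule.span_le]
      rintro _ ⟨i, rfl⟩
      have : ((b i + x • N (b i) : V) : MvPolynomial σ K) = ∑ j, B i j * (u + x • v) j := by
        simp [N, mul_add, Finset.sum_add_distrib, hBu, Finset.smul_sum]
      change ((b i + x • N (b i) : V) : MvPolynomial σ K) ∈ Ideal.span (Set.range (u + x • v))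
      rw [this]
      exact Ideal.sum_mem _ fun j _ => Ideal.mul_mem_left _ _ (Ideal.subset_span ⟨j, rfl⟩)
    exact hle (Submodule.mem_top (x := p))
  refine ((Module.End.finite_hasEigenvalue N).preimage (f := fun x : K => -x⁻¹)
    (fun x _ y _ hxy => by simpa using hxy)).subset fun x hx => ?_
  by_contra hne
  refine hx fun p hp => ?_
  have hinj : Function.Injective (LinearMap.id + x • N : Module.End K V) := by
    refine (injective_iff_map_eq_zero _).2 fun q hq => ?_
    by_contra hq0
    have hq' : q + x • N q = 0 := hq
    have hx0 : x ≠ 0 := by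
      rintro rfl
      simp [hq0] at hq'
    refine hne (Module.End.hasEigenvalue_of_hasEigenvector (x := q) ?_)
    refine ⟨Module.End.mem_eigenspace_iff.2 ?_, hq0⟩
    have : x • (N q - (-x⁻¹) • q) = 0 := by
      rw [smul_sub, smul_smul, mul_neg, mul_inv_cancel₀ hx0, ← hq']; module
    exact sub_eq_zero.1 ((smul_eq_zero.1 this).resolve_left hx0)
  obtain ⟨q, hq⟩ := LinearMap.injective_iff_surjective.1 hinj ⟨p, hp⟩
  have := hmem x q
  rwa [show q + x • N q = ⟨p, hp⟩ from hq] at this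

end GradedIdeals

section CompleteIntersections

variable {σ K : Type*} [Field K]

lemma mem_span_X_pow_image {e : ℕ} {T : Set σ} {p : MvPolynomial σ K} :
    p ∈ Ideal.span ((fun j => (X j : MvPolynomial σ K) ^ e) '' T) ↔
      ∀ m ∈ p.support, ∃ j ∈ T, e ≤ m j := by
  have h := mem_ideal_span_monomial_image (x := p) (s := (fun i => Finsupp.single i e) '' T)
  rw [Set.image_image] at h
  simp_rw [X_pow_eq_monomial]
  refine h.trans ?_
  simp

lemma regularFamily_X_pow (e : ℕ) : RegularFamily fun j : σ => (X j : MvPolynomial σ K) ^ e := by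
  intro T i hi p hp
  rw [mem_span_X_pow_image] at hp ⊢
  intro m hm
  obtain ⟨j, hj, hjm⟩ := hp (Finsupp.single i e + m) (by
    rw [mem_support_iff] at hm ⊢
    change coeff _ (X i ^ e * p) ≠ 0
    rwa [X_pow_eq_monomial, coeff_monomial_mul, one_mul])
  refine ⟨j, hj, ?_⟩
  have hij : i ≠ j := by rintro rfl; exact hi hj
  simpa [Finsupp.single_apply, hij] using hjm

lemma containsForms_span_X_pow [Fintype σ] (e : ℕ) {s : ℕ} (hs : Fintype.card σ * (e - 1) < s) :
    ContainsForms (Ideal.span (Set.range fun j : σ => (X j : MvPolynomial σ K) ^ e)) s := by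
  intro p hp
  rw [← Set.image_univ, mem_span_X_pow_image]
  intro m hm
  by_contra! h
  have h1 : m.degree ≤ Fintype.card σ * (e - 1) := by
    rw [Finsupp.degree_eq_sum, ← smul_eq_mul, ← Finset.card_univ]
    exact Finset.sum_le_card_nsmul _ _ _ fun i _ => by have := h i trivial; omega
  have hd : s = m.degree := hp.degree_eq_sum_deg_support hm
  omega

lemma finrank_homogeneousSubmodule_le [Fintype σ] [DecidableEq σ] (e s : ℕ) :
    Module.finrank K (homogeneousSubmodule σ K s) ≤
      gradedRank (Ideal.span (Set.range fun j : σ => (X j : MvPolynomial σ K) ^ e)) s +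
        (Finset.univ.filter fun α : σ → Fin e => ∑ i, (α i : ℕ) = s).card := by
  classical
  set I := Ideal.span (Set.range fun j : σ => (X j : MvPolynomial σ K) ^ e) with hI
  let F := Finset.univ.filter fun α : σ → Fin e => ∑ i, (α i : ℕ) = s
  let w : (σ → Fin e) → MvPolynomial σ K := fun α =>
    monomial (Finsupp.equivFunOnFinite.symm fun i => (α i : ℕ)) 1
  have hle : homogeneousSubmodule σ K s ≤
      (I.restrictScalars K ⊓ homogeneousSubmodule σ K s) ⊔ Submodule.span K (F.image w : Set _) := by
    intro p hp
    rw [p.as_sum]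
    refine Submodule.sum_mem _ fun m hm => ?_
    have hdeg : m.degree = s := (hp.degree_eq_sum_deg_support hm).symm
    by_cases h : ∃ j, e ≤ m j
    · refine Submodule.mem_sup_left ⟨?_, isHomogeneous_monomial _ hdeg⟩
      obtain ⟨j, hj⟩ := h
      change _ ∈ I
      rw [hI, ← Set.image_univ, mem_span_X_pow_image]
      intro m' hm'
      have := support_monomial_subset hm'
      rw [Finset.mem_singleton] at this
      exact ⟨j, trivial, this ▸ hj⟩
    · push Not at h
      refine Submodule.mem_sup_right ?_
      have : monomial m (coeff m p) = coeff m p • w fun i => ⟨m i, h i⟩ := by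
        have hm' : (Finsupp.equivFunOnFinite.symm fun i => m i) = m := by ext; simp
        simp only [w, hm', smul_monomial, smul_eq_mul, mul_one]
      rw [this]
      refine Submodule.smul_mem _ _ (Submodule.subset_span ?_)
      refine Finset.mem_coe.2 (Finset.mem_image_of_mem _ ?_)
      simp only [F, Finset.mem_filter, Finset.mem_univ, true_and]
      rw [← hdeg, Finsupp.degree_eq_sum]
  calc Module.finrank K (homogeneousSubmodule σ K s)
      ≤ _ := Submodule.finrank_mono hle
    _ ≤ _ := Submodule.finrank_add_le_finrank_add_finrank _ _
    _ ≤ _ := by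
      refine Nat.add_le_add le_rfl ((finrank_span_finset_le_card _).trans Finset.card_image_le)

/-- Any family of as many forms of degree `e` as variables, generating all forms of large degree,
has the Hilbert function of the family of `e`-th powers of the variables. -/
lemma gradedRank_span_range_eq [Fintype σ] [Infinite K] {g : σ → MvPolynomial σ K} {e : ℕ}
    (he : 0 < e) (hg : ∀ i, (g i).IsHomogeneous e) {s₀ : ℕ}
    (h : ContainsForms (Ideal.span (Set.range g)) s₀) (s : ℕ) :
    gradedRank (Ideal.span (Set.range g)) s =
      gradedRank (Ideal.span (Set.range fun j : σ => (X j : MvPolynomial σ K) ^ e)) s := by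
  classical
  set y : σ → MvPolynomial σ K := fun j => X j ^ e with hy_def
  have hy : ∀ i, (y i).IsHomogeneous e := fun i => isHomogeneous_X_pow i e
  set t := s₀ + Fintype.card σ * (e - 1) + 1
  have hgt : ContainsForms (Ideal.span (Set.range g)) (e + t) := h.mono (by omega)
  have hyt : ContainsForms (Ideal.span (Set.range y)) (e + t) :=
    containsForms_span_X_pow e (by omega)
  have h0 : ∀ i, ((0 : σ → MvPolynomial σ K) i).IsHomogeneous e := fun i => isHomogeneous_zero _ _ _
  have hfin1 : (⋃ S : Finset σ, {x : K | ¬ ContainsForms (Ideal.span (Set.range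
      (g + x • (S.piecewise y 0)))) (e + t)}).Finite :=
    Set.finite_iUnion fun S =>
      finite_not_containsForms_add_smul hg (isHomogeneous_piecewise h0 hy S) hgt
  have hfin2 : (⋃ S : Finset σ, {x : K | ¬ ContainsForms (Ideal.span (Set.range
      (y + x • (S.piecewise g 0)))) (e + t)}).Finite :=
    Set.finite_iUnion fun S =>
      finite_not_containsForms_add_smul hy (isHomogeneous_piecewise h0 hg S) hyt
  obtain ⟨x, hx⟩ := ((hfin1.union (hfin2.preimage (f := fun x : K => x⁻¹)
    inv_injective.injOn)).union (Set.finite_singleton 0)).exists_notMem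
  simp only [Set.mem_union, Set.mem_iUnion, Set.mem_ofPred_eq, Set.mem_preimage,
    Set.mem_singleton_iff, not_or, not_exists, not_not] at hx
  obtain ⟨⟨hx1, hx2⟩, hx0⟩ := hx
  have hh : ∀ i, ((g + x • y) i).IsHomogeneous e := fun i =>
    (homogeneousSubmodule σ K e).add_mem (hg i) ((homogeneousSubmodule σ K e).smul_mem x (hy i))
  have hz : ∀ S : Finset σ,
      ContainsForms (Ideal.span (Set.range (S.piecewise g (g + x • y)))) (e + t) := by
    intro S
    convert hx1 Sᶜ using 3
    ext1 j
    by_cases hj : j ∈ S <;> simp [hj]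
  have hw : ∀ S : Finset σ,
      ContainsForms (Ideal.span (Set.range (S.piecewise (g + x • y) y))) (e + t) := by
    intro S p hp
    refine Ideal.span_le.2 ?_ (hx2 S p hp)
    rintro _ ⟨j, rfl⟩
    by_cases hj : j ∈ S
    · have : (y + x⁻¹ • S.piecewise g 0) j = C x⁻¹ * S.piecewise (g + x • y) y j := by
        simp only [hj, Pi.add_apply, Pi.smul_apply, Finset.piecewise_eq_of_mem, mul_add,
          ← MvPolynomial.smul_eq_C_mul, smul_smul, inv_mul_cancel₀ hx0, one_smul]
        rw [add_comm]
      rw [this]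
      exact Ideal.mul_mem_left _ _ (Ideal.subset_span ⟨j, rfl⟩)
    · exact Ideal.subset_span ⟨j, by simp [hj]⟩
  obtain ⟨hreg, hr1⟩ := (regularFamily_X_pow e).of_piecewise he hy hh hw
  obtain ⟨-, hr2⟩ := hreg.of_piecewise he hh hg hz
  rw [hr2, hr1]

/-- The forms of degree `s` modulo an ideal generated by as many forms of degree `e` as variables
are spanned by as many elements as there are monomials of degree `s` with exponents below `e`. -/
lemma exists_spanning_family [Fintype σ] [Infinite K] {g : σ → MvPolynomial σ K} {e : ℕ}
    (he : 0 < e) (hg : ∀ i, (g i).IsHomogeneous e) {s₀ : ℕ}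
    (h : ContainsForms (Ideal.span (Set.range g)) s₀) (s : ℕ) :
    ∃ w : (σ → Fin e) → MvPolynomial σ K, ∀ p : MvPolynomial σ K, p.IsHomogeneous s →
      ∃ q, q.IsHomogeneous s ∧ q ∈ Ideal.span (Set.range g) ∧
        p - q ∈ Submodule.span K (w '' {α | ∑ i, (α i : ℕ) = s}) := by
  classical
  set I := Ideal.span (Set.range g)
  let F := Finset.univ.filter fun α : σ → Fin e => ∑ i, (α i : ℕ) = s
  let W := (I.restrictScalars K ⊓ homogeneousSubmodule σ K s)
  obtain ⟨U, hU⟩ := Submodule.exists_isCompl (W.comap (homogeneousSubmodule σ K s).subtype)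
  have hWr : Module.finrank K (W.comap (homogeneousSubmodule σ K s).subtype) = gradedRank I s := by
    exact LinearEquiv.finrank_eq (Submodule.comapSubtypeEquivOfLe inf_le_right)
  have hcard : Module.finrank K U ≤ F.card := by
    have h1 := Submodule.finrank_add_eq_of_isCompl hU
    have h2 := finrank_homogeneousSubmodule_le (K := K) (σ := σ) e s
    rw [← gradedRank_span_range_eq he hg h] at h2
    change _ ≤ gradedRank I s + F.card at h2
    omega
  have hcard' : Fintype.card (Fin (Module.finrank K U)) ≤ Fintype.card F := by simpa using hcard
  obtain ⟨ι⟩ := Function.Embedding.nonempty_of_card_le hcard'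
  have : Module.Free K U := Module.Free.of_divisionRing K U
  let b := Module.finBasis K U
  let w : (σ → Fin e) → MvPolynomial σ K :=
    Function.extend (fun i => (ι i : σ → Fin e)) (fun i => ((b i : homogeneousSubmodule σ K s) :
      MvPolynomial σ K)) 0
  have hinj : Function.Injective fun i => (ι i : σ → Fin e) :=
    Subtype.val_injective.comp ι.injective
  refine ⟨w, fun p hp => ?_⟩
  have hp' : (⟨p, hp⟩ : homogeneousSubmodule σ K s) ∈
      W.comap (homogeneousSubmodule σ K s).subtype ⊔ U := by
    rw [hU.sup_eq_top]; trivial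
  obtain ⟨q, hq, u, hu, hqu⟩ := Submodule.mem_sup.1 hp'
  refine ⟨q, q.2, hq.1, ?_⟩
  have : p - q = u := by
    rw [sub_eq_iff_eq_add, add_comm]
    exact (congrArg Subtype.val hqu).symm
  rw [this]
  have hle : (⊤ : Submodule K U) ≤ (Submodule.span K (w '' {α | ∑ i, (α i : ℕ) = s})).comap
      ((homogeneousSubmodule σ K s).subtype ∘ₗ U.subtype) := by
    rw [← b.span_eq, Submodule.span_le]
    rintro _ ⟨i, rfl⟩
    refine Submodule.subset_span ⟨ι i, ?_, ?_⟩
    · exact (Finset.mem_filter.1 (ι i).2).2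
    · exact hinj.extend_apply _ _ i
  exact hle (Submodule.mem_top (x := ⟨u, hu⟩))

/-- Macaulay's bound for complete intersections. -/
lemma containsForms_of_lt [Fintype σ] [Infinite K] {g : σ → MvPolynomial σ K} {e : ℕ}
    (he : 0 < e) (hg : ∀ i, (g i).IsHomogeneous e) {s₀ : ℕ}
    (h : ContainsForms (Ideal.span (Set.range g)) s₀) {s : ℕ}
    (hs : Fintype.card σ * (e - 1) < s) : ContainsForms (Ideal.span (Set.range g)) s := by
  intro p hp
  obtain ⟨w, hw⟩ := exists_spanning_family he hg h s
  obtain ⟨q, -, hq, hpq⟩ := hw p hp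
  have hempty : {α : σ → Fin e | ∑ i, (α i : ℕ) = s} = ∅ := by
    refine Set.eq_empty_of_forall_notMem fun α hα => ?_
    have : ∑ i, (α i : ℕ) ≤ Fintype.card σ * (e - 1) := by
      rw [← smul_eq_mul, ← Finset.card_univ]
      exact Finset.sum_le_card_nsmul _ _ _ fun i _ => by have := (α i).2; omega
    have hα' : ∑ i, (α i : ℕ) = s := hα
    omega
  rw [hempty, Set.image_empty, Submodule.span_empty, Submodule.mem_bot, sub_eq_zero] at hpq
  rwa [hpq]

/-- A graded ideal of finite codimension contains all forms of large degree. -/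
lemma exists_containsForms_of_finite {I : Ideal (MvPolynomial σ K)} (hI : IsGradedIdeal I)
    (h : Module.Finite K (MvPolynomial σ K ⧸ I)) : ∃ s, ContainsForms I s := by
  obtain ⟨S, hS⟩ := h.fg_top
  choose lift hlift using Ideal.Quotient.mk_surjective (I := I)
  refine ⟨(S.sup fun x => (lift x).totalDegree) + 1, fun p hp => ?_⟩
  set N := S.sup fun x => (lift x).totalDegree
  have hle : (⊤ : Submodule K (MvPolynomial σ K ⧸ I)) ≤
      (restrictTotalDegree σ K N).map (Ideal.Quotient.mkₐ K I).toLinearMap := by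
    rw [← hS, Submodule.span_le]
    intro x hx
    exact ⟨lift x, (mem_restrictTotalDegree _ _ _).2
      (Finset.le_sup (f := fun x => (lift x).totalDegree) hx), hlift x⟩
  obtain ⟨q, hq, hqp⟩ := hle (Submodule.mem_top (x := Ideal.Quotient.mk I p))
  have hmem : p - q ∈ I := Ideal.Quotient.eq.1 hqp.symm
  have h1 := hI _ hmem (N + 1)
  have hq' := (mem_restrictTotalDegree _ _ _).1 hq
  rwa [map_sub, homogeneousComponent_eq_self hp,
    homogeneousComponent_eq_zero _ _ (by omega), sub_zero] at h1

end CompleteIntersections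

section DegreeInT

variable {σ R : Type*} [CommRing R]

lemma degT_le_iff {p : MvPolynomial σ (Polynomial R)} {N : ℕ} :
    degT p ≤ N ↔ ∀ m, (p.coeff m).natDegree ≤ N := by
  rw [degT, Finset.sup_le_iff]
  refine ⟨fun h m => ?_, fun h m _ => h m⟩
  by_cases hm : m ∈ p.support
  · exact h m hm
  · rw [notMem_support_iff.1 hm, Polynomial.natDegree_zero]
    exact Nat.zero_le _

lemma natDegree_coeff_le_degT (p : MvPolynomial σ (Polynomial R)) (m : σ →₀ ℕ) :
    (p.coeff m).natDegree ≤ degT p :=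
  degT_le_iff.1 le_rfl m

lemma degT_add_le {p q : MvPolynomial σ (Polynomial R)} {N : ℕ} (hp : degT p ≤ N)
    (hq : degT q ≤ N) : degT (p + q) ≤ N := by
  rw [degT_le_iff] at *
  intro m
  rw [coeff_add]
  exact Polynomial.natDegree_add_le_of_degree_le (hp m) (hq m)

lemma degT_neg (p : MvPolynomial σ (Polynomial R)) : degT (-p) = degT p := by
  simp [degT]

lemma degT_sub_le {p q : MvPolynomial σ (Polynomial R)} {N : ℕ} (hp : degT p ≤ N)
    (hq : degT q ≤ N) : degT (p - q) ≤ N := by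
  rw [sub_eq_add_neg]
  exact degT_add_le hp ((degT_neg q).trans_le hq)

lemma degT_sum_le {ι : Type*} (s : Finset ι) {p : ι → MvPolynomial σ (Polynomial R)} {N : ℕ}
    (hp : ∀ i ∈ s, degT (p i) ≤ N) : degT (∑ i ∈ s, p i) ≤ N := by
  simp only [degT_le_iff] at *
  intro m
  rw [coeff_sum]
  exact Polynomial.natDegree_sum_le_of_forall_le _ _ fun i hi => hp i hi m

lemma degT_mul_le {p q : MvPolynomial σ (Polynomial R)} {M N : ℕ} (hp : degT p ≤ M)
    (hq : degT q ≤ N) : degT (p * q) ≤ M + N := by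
  classical
  rw [degT_le_iff] at *
  intro m
  rw [coeff_mul]
  exact Polynomial.natDegree_sum_le_of_forall_le _ _ fun x _ =>
    Polynomial.natDegree_mul_le_of_le (hp _) (hq _)

lemma degT_monomial_le (m : σ →₀ ℕ) (c : Polynomial R) : degT (monomial m c) ≤ c.natDegree := by
  classical
  rw [degT_le_iff]
  intro m'
  rw [coeff_monomial]
  split_ifs <;> simp

lemma degT_C_mul_le {p : MvPolynomial σ (Polynomial R)} {c : Polynomial R} {M N : ℕ}
    (hc : c.natDegree ≤ M) (hp : degT p ≤ N) : degT (C c * p) ≤ M + N :=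
  degT_mul_le ((degT_monomial_le 0 c).trans hc) hp

lemma degT_natCast_mul_le {p : MvPolynomial σ (Polynomial R)} {N : ℕ} (c : ℕ)
    (hp : degT p ≤ N) : degT ((c : MvPolynomial σ (Polynomial R)) * p) ≤ N := by
  have h := degT_C_mul_le (c := (c : Polynomial R)) (Polynomial.natDegree_natCast c).le hp
  rwa [map_natCast, zero_add] at h

lemma degT_pow_le {p : MvPolynomial σ (Polynomial R)} {N : ℕ} (hp : degT p ≤ N) (j : ℕ) :
    degT (p ^ j) ≤ j * N := by
  induction j with
  | zero =>
    rw [pow_zero, zero_mul]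
    exact (degT_monomial_le 0 1).trans Polynomial.natDegree_one.le
  | succ j ih =>
    rw [pow_succ, Nat.succ_mul]
    exact degT_mul_le ih hp

lemma degT_pderiv_le {p : MvPolynomial σ (Polynomial R)} {N : ℕ} (hp : degT p ≤ N) (i : σ) :
    degT (pderiv i p) ≤ N := by
  rw [degT_le_iff] at *
  intro m
  rw [coeff_pderiv, ← Nat.cast_one (R := Polynomial R), ← Nat.cast_add]
  exact Polynomial.natDegree_mul_le_of_le (hp _) (Polynomial.natDegree_natCast _).le

lemma coeff_dtMv (p : MvPolynomial σ (Polynomial R)) (m : σ →₀ ℕ) :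
    (dtMv p).coeff m = Polynomial.derivative (p.coeff m) := by
  classical
  rw [dtMv, coeff_sum]
  simp only [coeff_monomial, Finset.sum_ite_eq']
  split_ifs with h
  · rfl
  · rw [notMem_support_iff.1 h, Polynomial.derivative_zero]

lemma degT_dtMv_le {p : MvPolynomial σ (Polynomial R)} {N : ℕ} (hp : degT p ≤ N) :
    degT (dtMv p) ≤ N := by
  rw [degT_le_iff] at *
  intro m
  rw [coeff_dtMv]
  exact (Polynomial.natDegree_derivative_le _).trans ((Nat.sub_le _ _).trans (hp m))

lemma isHomogeneous_dtMv {p : MvPolynomial σ (Polynomial R)} {s : ℕ} (hp : p.IsHomogeneous s) :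
    (dtMv p).IsHomogeneous s := by
  intro m hm
  refine hp fun h => hm ?_
  rw [coeff_dtMv, h, Polynomial.derivative_zero]

lemma isHomogeneous_telSeq {f a : MvPolynomial σ (Polynomial R)} {d s : ℕ}
    (hf : f.IsHomogeneous d) (ha : a.IsHomogeneous s) (ℓ j : ℕ) :
    (telSeq dtMv f a ℓ j).IsHomogeneous (s + j * d) := by
  induction j with
  | zero => simpa [telSeq] using ha
  | succ j ih =>
    refine IsHomogeneous.sub ?_ ?_
    · rw [show s + (j + 1) * d = d + (s + j * d) by ring]
      exact hf.mul (isHomogeneous_dtMv ih)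
    · have h := ((isHomogeneous_C (σ := σ) ((ℓ + j : ℕ) : Polynomial R)).mul ih).mul
        (isHomogeneous_dtMv hf)
      rw [map_natCast] at h
      rwa [show 0 + (s + j * d) + d = s + (j + 1) * d by ring] at h

lemma degT_telSeq_le (f a : MvPolynomial σ (Polynomial R)) (ℓ j : ℕ) :
    degT (telSeq dtMv f a ℓ j) ≤ degT a + j * degT f := by
  induction j with
  | zero => simp [telSeq]
  | succ j ih =>
    rw [Nat.succ_mul, ← add_assoc]
    refine degT_sub_le ?_ ?_
    · rw [add_comm]
      exact degT_mul_le le_rfl (degT_dtMv_le ih)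
    · exact degT_mul_le (degT_natCast_mul_le _ ih) (degT_dtMv_le le_rfl)

lemma natDegree_det_le {κ : Type*} [Fintype κ] [DecidableEq κ] (M : Matrix κ κ (Polynomial R))
    {β : κ → ℕ} (h : ∀ i j, (M i j).natDegree ≤ β j) : M.det.natDegree ≤ ∑ j, β j := by
  rw [Matrix.det_apply]
  refine Polynomial.natDegree_sum_le_of_forall_le _ _ fun τ _ => ?_
  refine (Polynomial.natDegree_smul_le _ _).trans ((Polynomial.natDegree_prod_le _ _).trans ?_)
  exact Finset.sum_le_sum fun i _ => h _ _

end DegreeInT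

section CramerBounds

lemma exists_det_coeff_ne_zero {σ K κ : Type*} [Field K] [Fintype κ] [DecidableEq κ]
    {v : κ → MvPolynomial σ K} (hv : LinearIndependent K v) :
    ∃ ρ : κ → σ →₀ ℕ, (Matrix.of fun j i => (v i).coeff (ρ j)).det ≠ 0 := by
  set row : (σ →₀ ℕ) → κ → K := fun m i => (v i).coeff m
  have htop : Submodule.span K (Set.range row) = ⊤ := by
    by_contra hne
    obtain ⟨φ, hφ0, hφ⟩ := Submodule.exists_le_ker_of_lt_top _ (lt_top_iff_ne_top.2 hne)
    refine hφ0 (LinearMap.pi_ext' fun i => LinearMap.ext_ring ?_)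
    have hsum : ∑ i, φ (Pi.single i 1) • v i = 0 := by
      ext m
      have h1 : φ (row m) = 0 := hφ (Submodule.subset_span ⟨m, rfl⟩)
      rw [LinearMap.pi_apply_eq_sum_univ φ (row m)] at h1
      rw [coeff_sum, coeff_zero, ← h1]
      refine Finset.sum_congr rfl fun i _ => ?_
      rw [coeff_smul, smul_eq_mul, smul_eq_mul, mul_comm]
      congr 2
      ext j
      simp [Pi.single_apply, eq_comm]
    exact Fintype.linearIndependent_iff.1 hv _ hsum i
  obtain ⟨g, hg, -, hli⟩ := Submodule.exists_fun_fin_finrank_span_eq K (Set.range row)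
  have hcard : Fintype.card κ = Module.finrank K (Submodule.span K (Set.range row)) := by
    rw [htop, finrank_top, Module.finrank_fintype_fun_eq_card]
  let E : κ ≃ Fin (Module.finrank K (Submodule.span K (Set.range row))) :=
    (Fintype.equivFin κ).trans (finCongr hcard)
  choose ρ hρ using hg
  refine ⟨fun j => ρ (E j), ?_⟩
  have h : LinearIndependent K (Matrix.of fun j i => (v i).coeff (ρ (E j))).row := by
    have h := hli.comp E E.injective
    rwa [show g ∘ E = (Matrix.of fun j i => (v i).coeff (ρ (E j))).row from
      funext fun j => (hρ (E j)).symm] at h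
  exact ((Matrix.isUnit_iff_isUnit_det _).1 (Matrix.linearIndependent_rows_iff_isUnit.1 h)).ne_zero

variable {σ k κ : Type*} [Field k]

/-- Coordinates along linearly independent polynomials, with a common denominator of
controlled degree. -/
lemma exists_common_denominator [Fintype κ] [DecidableEq κ] (p : κ → MvPolynomial σ (Polynomial k))
    {β : κ → ℕ} (hβ : ∀ i, degT (p i) ≤ β i)
    (hp : LinearIndependent (RatFunc k) fun i => map (algebraMap (Polynomial k) (RatFunc k)) (p i)) :
    ∃ Δ : Polynomial k, Δ ≠ 0 ∧ Δ.natDegree ≤ ∑ i, β i ∧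
      ∀ (v : MvPolynomial σ (Polynomial k)) (b : ℕ), degT v ≤ b →
        map (algebraMap (Polynomial k) (RatFunc k)) v ∈ Submodule.span (RatFunc k)
          (Set.range fun i => map (algebraMap (Polynomial k) (RatFunc k)) (p i)) →
        ∃ c : κ → Polynomial k, C Δ * v = ∑ i, C (c i) * p i ∧
          ∀ i, (c i).natDegree ≤ ∑ j, Function.update β i b j := by
  set φ := algebraMap (Polynomial k) (RatFunc k) with hφ
  have hφi : Function.Injective φ := IsFractionRing.injective _ _
  obtain ⟨ρ, hρ⟩ := exists_det_coeff_ne_zero hp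
  set M : Matrix κ κ (Polynomial k) := Matrix.of fun j i => (p i).coeff (ρ j) with hM
  have hMφ : (Matrix.of fun j i => (map φ (p i)).coeff (ρ j)) = φ.mapMatrix M := by
    ext j i
    simp [hM, coeff_map]
  rw [hMφ, ← RingHom.map_det] at hρ
  refine ⟨M.det, fun h => hρ (by rw [h, map_zero]),
    natDegree_det_le M fun i j => (natDegree_coeff_le_degT _ _).trans (hβ j), fun v b hb hv => ?_⟩
  obtain ⟨x, hx⟩ := (Submodule.mem_span_range_iff_exists_fun (RatFunc k)).1 hv
  set u : κ → Polynomial k := fun j => v.coeff (ρ j) with hu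
  have hMx : (φ.mapMatrix M).mulVec x = φ ∘ u := by
    ext1 j
    have := congrArg (coeff (ρ j)) hx
    rw [coeff_sum, coeff_map] at this
    simp only [Function.comp, hu, ← this, Matrix.mulVec, dotProduct]
    refine Finset.sum_congr rfl fun i _ => ?_
    rw [coeff_smul, smul_eq_mul, mul_comm, coeff_map]
    rfl
  have hc : ∀ i, φ (M.cramer u i) = φ M.det * x i := by
    have h2 : (φ.mapMatrix M).adjugate.mulVec (φ ∘ u) = (φ.mapMatrix M).det • x := by
      rw [← hMx, Matrix.mulVec_mulVec, Matrix.adjugate_mul, Matrix.smul_mulVec, Matrix.one_mulVec]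
    intro i
    have h3 := congrFun h2 i
    rw [← RingHom.map_adjugate, ← RingHom.map_det] at h3
    rw [Matrix.cramer_eq_adjugate_mulVec]
    simpa [RingHom.map_mulVec] using h3
  refine ⟨M.cramer u, ?_, fun i => ?_⟩
  · refine map_injective φ hφi ?_
    simp only [map_mul, map_sum, map_C, hc]
    rw [← hx, Finset.mul_sum]
    refine Finset.sum_congr rfl fun i _ => ?_
    rw [smul_eq_C_mul, mul_assoc]
  · rw [Matrix.cramer_apply]
    refine natDegree_det_le _ fun j i' => ?_
    rw [Matrix.updateCol_apply]
    by_cases h : i' = i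
    · subst h
      simp only [if_true, Function.update_self]
      exact (natDegree_coeff_le_degT _ _).trans hb
    · simp only [h, if_false, Function.update_of_ne h]
      exact (natDegree_coeff_le_degT _ _).trans (hβ i')

end CramerBounds

section BoundedRelations

/-- A linear relation between the `R j` modulo the span of the `m i` can be chosen with
polynomial coefficients of controlled degree. -/
lemma exists_relation_natDegree_le {σ k μ : Type*} [Field k] [Fintype μ] {r δ α N : ℕ}
    (m : μ → MvPolynomial σ (Polynomial k)) (R : Fin (r + 1) → MvPolynomial σ (Polynomial k))
    (hm : ∀ i, degT (m i) ≤ δ) (hR : ∀ j, degT (R j) ≤ α)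
    (hN : ∀ s : Finset μ, LinearIndepOn (RatFunc k)
      (fun i => map (algebraMap (Polynomial k) (RatFunc k)) (m i)) (s : Set μ) → s.card ≤ N)
    {x : Fin (r + 1) → RatFunc k} (hx : x ≠ 0)
    (hrel : ∑ j, x j • map (algebraMap (Polynomial k) (RatFunc k)) (R j) ∈
      Submodule.span (RatFunc k)
        (Set.range fun i => map (algebraMap (Polynomial k) (RatFunc k)) (m i))) :
    ∃ c : Fin (r + 1) → Polynomial k, c ≠ 0 ∧ (∀ j, (c j).natDegree ≤ N * δ + r * α) ∧
      map (algebraMap (Polynomial k) (RatFunc k)) (∑ j, C (c j) * R j) ∈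
        Submodule.span (RatFunc k)
          (Set.range fun i => map (algebraMap (Polynomial k) (RatFunc k)) (m i)) := by
  classical
  set φ := algebraMap (Polynomial k) (RatFunc k) with hφ
  let p : μ ⊕ Fin (r + 1) → MvPolynomial σ (Polynomial k) := Sum.elim m R
  let v : μ ⊕ Fin (r + 1) → MvPolynomial σ (RatFunc k) := fun i => map φ (p i)
  obtain ⟨b₁, hb₁r, -, hb₁s, hb₁⟩ := exists_linearIndepOn_extension
    (linearIndepOn_empty (RatFunc k) v) (Set.empty_subset (Set.range Sum.inl))
  obtain ⟨b, -, hbb₁, hbs, hb⟩ := exists_linearIndepOn_extension hb₁ (Set.subset_univ b₁)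
  have hmspan : Submodule.span (RatFunc k) (Set.range fun i => map φ (m i)) ≤
      Submodule.span (RatFunc k) (v '' b₁) := by
    refine Submodule.span_le.2 ?_
    rintro _ ⟨i, rfl⟩
    exact hb₁s ⟨Sum.inl i, ⟨i, rfl⟩, rfl⟩
  obtain ⟨j₀, hj₀⟩ : ∃ j, Sum.inr j ∉ b := by
    by_contra! hall
    obtain ⟨l, hl, hlx⟩ := (Finsupp.mem_span_image_iff_linearCombination _).1 (hmspan hrel)
    let x' : μ ⊕ Fin (r + 1) →₀ RatFunc k := Finsupp.equivFunOnFinite.symm (Sum.elim 0 x)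
    have h1 : Finsupp.linearCombination (RatFunc k) v (x' - l) = 0 := by
      rw [map_sub, hlx, sub_eq_zero, Finsupp.linearCombination_apply,
        Finsupp.sum_fintype _ _ (by simp), Fintype.sum_sum_type]
      simp [x', v, p]
    have hsupp : x' - l ∈ Finsupp.supported (RatFunc k) (RatFunc k) b := by
      refine Submodule.sub_mem _ ?_ (Finsupp.supported_mono hbb₁ hl)
      rw [Finsupp.mem_supported]
      rintro (i | j) hi
      · simp [x'] at hi
      · exact hall j
    have h2 := linearIndepOn_iff.1 hb _ hsupp h1
    refine hx (funext fun j => ?_)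
    have h3 := DFunLike.congr_fun h2 (Sum.inr j)
    have h4 : l (Sum.inr j) = 0 := by
      by_contra h
      obtain ⟨i, hi⟩ := hb₁r (hl (Finsupp.mem_support_iff.2 h))
      cases hi
    simpa [x', h4] using h3
  let β : μ ⊕ Fin (r + 1) → ℕ := Sum.elim (fun _ => δ) (fun _ => α)
  have hpβ : ∀ i, degT (p i) ≤ β i := by
    rintro (i | j)
    exacts [hm i, hR j]
  have hsumβ : ∑ i : b, β i ≤ N * δ + r * α := by
    have h1 : ∑ i : b, β i = ∑ i, if i ∈ b then β i else 0 := by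
      rw [← Finset.sum_filter]
      exact (Finset.sum_subtype _ (by simp) _).symm
    rw [h1, Fintype.sum_sum_type]
    simp only [β, Sum.elim_inl, Sum.elim_inr, ← Finset.sum_filter, Finset.sum_const, smul_eq_mul]
    refine Nat.add_le_add (Nat.mul_le_mul_right _ (hN _ ?_)) (Nat.mul_le_mul_right _ ?_)
    · have h2 := (hb.mono (t := Sum.inl '' {i | Sum.inl i ∈ b}) (by
        rintro _ ⟨i, hi, rfl⟩; exact hi)).comp_of_image Sum.inl_injective.injOn
      refine h2.mono ?_
      intro i hi
      simpa using hi
    · have h3 : (Finset.univ.filter fun j : Fin (r + 1) => Sum.inr j ∈ b) ⊆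
          Finset.univ.erase j₀ := by
        intro j hj
        refine Finset.mem_erase.2 ⟨?_, Finset.mem_univ _⟩
        rintro rfl
        exact hj₀ (Finset.mem_filter.1 hj).2
      simpa using Finset.card_le_card h3
  obtain ⟨Δ, hΔ0, hΔ, H⟩ := exists_common_denominator (fun i : b => p i) (β := fun i => β i)
    (fun i => hpβ i) hb
  obtain ⟨c, hc, hcdeg⟩ := H (R j₀) α (hR j₀) (by
    have := hbs ⟨Sum.inr j₀, trivial, rfl⟩
    rwa [Set.image_eq_range] at this)
  let c' : μ ⊕ Fin (r + 1) → Polynomial k := fun i => if h : i ∈ b then c ⟨i, h⟩ else 0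
  have hc' : C Δ * R j₀ = ∑ i, C (c' (Sum.inl i)) * m i + ∑ j, C (c' (Sum.inr j)) * R j := by
    have h1 : ∑ i : b, C (c i) * p i = ∑ i, C (c' i) * p i := by
      rw [← Finset.sum_subset (Finset.subset_univ b.toFinset), Finset.sum_subtype b.toFinset
        (p := (· ∈ b)) (by simp)]
      · refine Finset.sum_congr rfl fun i _ => ?_
        simp [c']
      · intro i _ hi
        have : i ∉ b := by simpa using hi
        simp [c', this]
    rw [hc, h1, Fintype.sum_sum_type]
    rfl
  refine ⟨Pi.single j₀ Δ - c' ∘ Sum.inr, fun h => hΔ0 ?_, fun j => ?_, ?_⟩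
  · have := congrFun h j₀
    simpa [c', hj₀] using this
  · refine (Polynomial.natDegree_sub_le_of_le (n := N * δ + r * α) ?_ ?_).trans (max_self _).le
    · by_cases h : j = j₀
      · subst h
        simpa using hΔ.trans hsumβ
      · simp [h]
    · simp only [Function.comp, c']
      split_ifs with h
      · refine (hcdeg _).trans (le_of_eq_of_le ?_ hsumβ)
        refine Finset.sum_congr rfl fun i _ => ?_
        by_cases hi : i = ⟨Sum.inr j, h⟩
        · subst hi; simp [β]
        · rw [Function.update_of_ne hi]
      · simp
  · have h1 : ∑ j, C ((Pi.single j₀ Δ - c' ∘ Sum.inr : Fin (r + 1) → Polynomial k) j) * R j =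
        ∑ i, C (c' (Sum.inl i)) * m i := by
      simp only [Pi.sub_apply, map_sub, sub_mul, Finset.sum_sub_distrib, Function.comp]
      rw [sub_eq_iff_eq_add, ← hc', Finset.sum_eq_single j₀]
      · simp
      · intro j _ hj; simp [hj]
      · simp
    rw [h1, map_sum]
    refine Submodule.sum_mem _ fun i _ => ?_
    rw [map_mul, map_C, ← smul_eq_C_mul]
    exact Submodule.smul_mem _ _ (Submodule.subset_span ⟨i, rfl⟩)

end BoundedRelations

section PoleDiv

variable {σ R : Type*} [Fintype σ] [CommRing R]

/-- The map `B ↦ ∑ᵢ (F ∂ᵢBᵢ − m Bᵢ ∂ᵢF)`, that is, `F ^ (m + 1)` times the divergence of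
`B / F ^ m`. -/
noncomputable def poleDiv (F : MvPolynomial σ R) (m : ℕ) :
    (σ → MvPolynomial σ R) →ₗ[R] MvPolynomial σ R where
  toFun B := ∑ i, (F * pderiv i (B i) - (m : MvPolynomial σ R) * B i * pderiv i F)
  map_add' B B' := by
    rw [← Finset.sum_add_distrib]
    refine Finset.sum_congr rfl fun i _ => ?_
    rw [Pi.add_apply, map_add]
    ring
  map_smul' c B := by
    rw [RingHom.id_apply, Finset.smul_sum]
    refine Finset.sum_congr rfl fun i _ => ?_
    rw [Pi.smul_apply, Derivation.map_smul, smul_sub, mul_smul_comm, mul_smul_comm, smul_mul_assoc]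

lemma poleDiv_apply (F : MvPolynomial σ R) (m : ℕ) (B : σ → MvPolynomial σ R) :
    poleDiv F m B = ∑ i, (F * pderiv i (B i) - (m : MvPolynomial σ R) * B i * pderiv i F) :=
  rfl

lemma poleDiv_eq_sub (F : MvPolynomial σ R) (m : ℕ) (B : σ → MvPolynomial σ R) :
    poleDiv F m B = F * ∑ i, pderiv i (B i) - (m : MvPolynomial σ R) * ∑ i, B i * pderiv i F := by
  rw [poleDiv_apply, Finset.sum_sub_distrib, Finset.mul_sum, Finset.mul_sum]
  simp only [mul_assoc]

lemma mul_poleDiv (F : MvPolynomial σ R) (m : ℕ) (B : σ → MvPolynomial σ R) :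
    F * poleDiv F m B = poleDiv F (m + 1) fun i => F * B i := by
  rw [poleDiv_apply, poleDiv_apply, Finset.mul_sum]
  refine Finset.sum_congr rfl fun i _ => ?_
  rw [pderiv_mul]
  push_cast
  ring

lemma pow_mul_mem_range_poleDiv {F : MvPolynomial σ R} {m : ℕ} {x : MvPolynomial σ R}
    (hx : x ∈ LinearMap.range (poleDiv F m)) (j : ℕ) :
    F ^ j * x ∈ LinearMap.range (poleDiv F (m + j)) := by
  induction j with
  | zero => simpa using hx
  | succ j ih =>
    obtain ⟨B, hB⟩ := ih
    exact ⟨fun i => F * B i, by rw [← add_assoc, ← mul_poleDiv, hB, pow_succ']; ring⟩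

lemma map_poleDiv {S : Type*} [CommRing S] (φ : R →+* S) (F : MvPolynomial σ R) (m : ℕ)
    (B : σ → MvPolynomial σ R) :
    map φ (poleDiv F m B) = poleDiv (map φ F) m fun i => map φ (B i) := by
  simp only [poleDiv_apply, map_sum, map_sub, map_mul, map_natCast, pderiv_map]

end PoleDiv

section PoleReduction

variable {σ k : Type*} [Fintype σ] [Field k]

lemma card_le_of_linearIndepOn_isHomogeneous {ι K : Type*} [Field K] {v : ι → MvPolynomial σ K}
    {s N : ℕ} (hN : Module.finrank K (homogeneousSubmodule σ K s) ≤ N)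
    (hv : ∀ i, (v i).IsHomogeneous s) (b : Finset ι) (hb : LinearIndepOn K v (b : Set ι)) :
    b.card ≤ N := by
  let w : b → homogeneousSubmodule σ K s := fun i => ⟨v i, hv i⟩
  have hw : LinearIndependent K w :=
    LinearIndependent.of_comp (homogeneousSubmodule σ K s).subtype hb
  have := hw.fintype_card_le_finrank
  rw [Fintype.card_coe] at this
  exact this.trans hN

/-- If forms `g i` generate all forms of degree `e + t` over `k(t)`, then every form of degree at
least `e + t` is, up to a common factor of controlled degree, a combination of the `g i` with
coefficients of controlled degree. -/
lemma exists_mul_eq_sum {g : σ → MvPolynomial σ (Polynomial k)} {e t δ N : ℕ}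
    (hg : ∀ i, (g i).IsHomogeneous e) (hgδ : ∀ i, degT (g i) ≤ δ)
    (hN : Module.finrank (RatFunc k) (homogeneousSubmodule σ (RatFunc k) (e + t)) ≤ N)
    (h : ContainsForms (Ideal.span (Set.range fun i =>
      map (algebraMap (Polynomial k) (RatFunc k)) (g i))) (e + t)) :
    ∃ Δ : Polynomial k, Δ ≠ 0 ∧ ∀ (u b : ℕ) (p : MvPolynomial σ (Polynomial k)),
      p.IsHomogeneous (e + t + u) → degT p ≤ b →
      ∃ B : σ → MvPolynomial σ (Polynomial k), (∀ i, (B i).IsHomogeneous (t + u)) ∧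
        (∀ i, degT (B i) ≤ b + N * δ) ∧ C Δ * p = ∑ i, B i * g i := by
  classical
  set φ := algebraMap (Polynomial k) (RatFunc k) with hφ
  let μ := {m : σ →₀ ℕ // m.degree = t} × σ
  let col : μ → MvPolynomial σ (Polynomial k) := fun i => monomial i.1.1 1 * g i.2
  have hcolδ : ∀ i, degT (col i) ≤ δ := fun i => by
    simpa using degT_mul_le (degT_monomial_le i.1.1 1) (hgδ i.2)
  have hcol : ∀ i, (map φ (col i)).IsHomogeneous (e + t) := fun i => by
    rw [add_comm]
    exact ((isHomogeneous_monomial (1 : Polynomial k) i.1.2).mul (hg i.2)).map φ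
  have hspan : ∀ p : MvPolynomial σ (RatFunc k), p.IsHomogeneous (e + t) →
      p ∈ Submodule.span (RatFunc k) (Set.range fun i => map φ (col i)) := by
    intro p hp
    obtain ⟨B, hB, rfl⟩ := exists_isHomogeneous_of_mem_span_range (fun i => (hg i).map φ) hp (h p hp)
    refine Submodule.sum_mem _ fun i _ => ?_
    rw [(B i).as_sum, Finset.sum_mul]
    refine Submodule.sum_mem _ fun m hm => ?_
    have hdeg : m.degree = t := ((hB i).degree_eq_sum_deg_support hm).symm
    have : monomial m (coeff m (B i)) * map φ (g i) =
        coeff m (B i) • map φ (col (⟨m, hdeg⟩, i)) := by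
      simp only [col, map_mul, map_monomial, map_one]
      rw [← smul_mul_assoc, smul_monomial, smul_eq_mul, mul_one]
    rw [this]
    exact Submodule.smul_mem _ _ (Submodule.subset_span ⟨_, rfl⟩)
  obtain ⟨b, -, -, hbs, hb⟩ := exists_linearIndepOn_extension
    (linearIndepOn_empty (RatFunc k) fun i => map φ (col i)) (Set.empty_subset Set.univ)
  have : Finite {m : σ →₀ ℕ // m.degree = t} := Finsupp.finite_of_degree_eq t
  let _ : Fintype μ := Fintype.ofFinite _
  have hcard : Fintype.card b ≤ N := by
    rw [← Set.toFinset_card]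
    exact card_le_of_linearIndepOn_isHomogeneous hN hcol b.toFinset (by simpa using hb)
  obtain ⟨Δ, hΔ0, -, H⟩ := exists_common_denominator (fun i : b => col i) (β := fun _ => δ)
    (fun i => hcolδ i) hb
  have hmono : ∀ m : σ →₀ ℕ, m.degree = e + t → ∃ B : σ → MvPolynomial σ (Polynomial k),
      (∀ i, (B i).IsHomogeneous t) ∧ (∀ i, degT (B i) ≤ N * δ) ∧
        C Δ * monomial m 1 = ∑ i, B i * g i := by
    intro m hm
    obtain ⟨c, hc, hcdeg⟩ := H (monomial m 1) 0 (by simpa using degT_monomial_le m 1) (by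
      have h1 := hspan _ ((isHomogeneous_monomial (1 : Polynomial k) hm).map φ)
      refine Submodule.span_le.2 ?_ h1
      rw [← Set.image_eq_range (fun i => map φ (col i)) b, ← Set.image_univ]
      exact hbs)
    refine ⟨fun i => ∑ j : b with j.1.2 = i, C (c j) * monomial j.1.1.1 1, fun i => ?_,
      fun i => ?_, ?_⟩
    · refine IsHomogeneous.sum _ _ _ fun j _ => ?_
      have h1 := (isHomogeneous_C σ (c j)).mul
        (isHomogeneous_monomial (1 : Polynomial k) j.1.1.2)
      rwa [zero_add] at h1
    · refine degT_sum_le _ fun j _ => ?_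
      refine degT_C_mul_le (N := 0) ((hcdeg j).trans ?_) (by simpa using degT_monomial_le j.1.1.1 1)
      calc ∑ x, Function.update (fun _ => δ) j 0 x ≤ ∑ x : b, δ :=
            Finset.sum_le_sum fun x _ => by
              by_cases hx : x = j <;> simp [hx]
        _ ≤ N * δ := by
            rw [Finset.sum_const, Finset.card_univ, smul_eq_mul]
            exact Nat.mul_le_mul_right _ hcard
    · rw [hc, ← Finset.sum_fiberwise Finset.univ (fun j : b => j.1.2)]
      refine Finset.sum_congr rfl fun i _ => ?_
      rw [Finset.sum_mul]
      refine Finset.sum_congr rfl fun j hj => ?_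
      rw [← (Finset.mem_filter.1 hj).2, mul_assoc]
  refine ⟨Δ, hΔ0, fun u b' p hp hb' => ?_⟩
  choose! B hB hBdeg hBeq using hmono
  have hsplit : ∀ m ∈ p.support, ∃ m' ≤ m, m'.degree = e + t := fun m hm =>
    Finsupp.exists_le_degree_eq m _ (by
      have : e + t + u = m.degree := hp.degree_eq_sum_deg_support hm
      omega)
  choose! m' hm'le hm' using hsplit
  have hrest : ∀ m ∈ p.support, (m - m' m).degree = u := fun m hm => by
    have h1 : e + t + u = m.degree := hp.degree_eq_sum_deg_support hm
    have h2 : (m' m + (m - m' m)).degree = m.degree := by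
      rw [add_tsub_cancel_of_le (hm'le m hm)]
    rw [map_add, hm' m hm] at h2
    omega
  refine ⟨fun i => ∑ m ∈ p.support, monomial (m - m' m) (p.coeff m) * B (m' m) i, fun i => ?_,
    fun i => ?_, ?_⟩
  · refine IsHomogeneous.sum _ _ _ fun m hm => ?_
    rw [add_comm]
    exact (isHomogeneous_monomial _ (hrest m hm)).mul (hB _ (hm' m hm) i)
  · refine degT_sum_le _ fun m hm => ?_
    exact degT_mul_le ((degT_monomial_le _ _).trans ((natDegree_coeff_le_degT p m).trans hb'))
      (hBdeg _ (hm' m hm) i)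
  · simp only [Finset.sum_mul]
    rw [Finset.sum_comm]
    conv_lhs => rw [p.as_sum, Finset.mul_sum]
    refine Finset.sum_congr rfl fun m hm => ?_
    simp only [mul_assoc, ← Finset.mul_sum]
    rw [← hBeq _ (hm' m hm), mul_left_comm, monomial_mul, mul_one, tsub_add_cancel_of_le (hm'le m hm)]

/-- Lowering the pole order by `j`, with control of the degree in `t`. -/
lemma exists_pole_reduction [CharZero k] {f : MvPolynomial σ (Polynomial k)} {e t n N : ℕ}
    {Δ : Polynomial k}
    (H : ∀ (u b : ℕ) (p : MvPolynomial σ (Polynomial k)),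
      p.IsHomogeneous (e + t + u) → degT p ≤ b →
      ∃ B : σ → MvPolynomial σ (Polynomial k), (∀ i, (B i).IsHomogeneous (t + u)) ∧
        (∀ i, degT (B i) ≤ b + N) ∧ C Δ * p = ∑ i, B i * pderiv i f) (j : ℕ) :
    ∀ (b : ℕ) (p : MvPolynomial σ (Polynomial k)),
      p.IsHomogeneous (e + t + j * (e + 1)) → degT p ≤ b →
      ∃ q : MvPolynomial σ (Polynomial k), q.IsHomogeneous (e + t) ∧ degT q ≤ b + j * N ∧
        map (algebraMap (Polynomial k) (RatFunc k)) (C (Δ ^ j) * p - f ^ j * q) ∈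
          LinearMap.range
            (poleDiv (map (algebraMap (Polynomial k) (RatFunc k)) f) (n + j)) := by
  set φ := algebraMap (Polynomial k) (RatFunc k) with hφ
  induction j with
  | zero =>
    intro b p hp hb
    exact ⟨p, by simpa using hp, by simpa using hb, by simp⟩
  | succ j ih =>
    intro b p hp hb
    obtain ⟨B, hB, hBdeg, hBeq⟩ := H _ b p hp hb
    set c : Polynomial k := Polynomial.C (((n + j + 1 : ℕ) : k)⁻¹) with hc
    have hcn : c * ((n + j + 1 : ℕ) : Polynomial k) = 1 := by
      rw [hc, ← map_natCast Polynomial.C, ← map_mul, inv_mul_cancel₀ (Nat.cast_ne_zero.2 (by omega)),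
        map_one]
    set p₁ := C c * ∑ i, pderiv i (B i) with hp₁
    have hp₁h : p₁.IsHomogeneous (e + t + j * (e + 1)) := by
      rw [hp₁, ← zero_add (e + t + j * (e + 1))]
      refine (isHomogeneous_C _ _).mul (IsHomogeneous.sum _ _ _ fun i _ => ?_)
      rw [show e + t + j * (e + 1) = t + (j + 1) * (e + 1) - 1 by
        rw [add_mul]; omega]
      exact (hB i).pderiv
    have hp₁b : degT p₁ ≤ b + N := by
      rw [hp₁, ← zero_add (b + N)]
      exact degT_C_mul_le (Polynomial.natDegree_C _).le
        (degT_sum_le _ fun i _ => degT_pderiv_le (hBdeg i) i)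
    obtain ⟨q, hq, hqdeg, hqmem⟩ := ih _ p₁ hp₁h hp₁b
    refine ⟨q, hq, by rw [add_mul, one_mul]; omega, ?_⟩
    have hstep : C Δ * p - f * p₁ = poleDiv f (n + j + 1) fun i => C (-c) * B i := by
      rw [poleDiv_eq_sub, hBeq, hp₁]
      simp only [pderiv_C_mul, mul_assoc, ← Finset.mul_sum]
      simp only [map_neg, neg_mul, mul_neg, sub_neg_eq_add]
      have : ((n + j + 1 : ℕ) : MvPolynomial σ (Polynomial k)) * C c = 1 := by
        rw [← map_natCast C, ← map_mul, mul_comm, hcn, map_one]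
      rw [← mul_assoc _ (C c) (∑ i, B i * pderiv i f), this, one_mul]
      ring
    have heq : C (Δ ^ (j + 1)) * p - f ^ (j + 1) * q =
        C (Δ ^ j) * poleDiv f (n + j + 1) (fun i => C (-c) * B i) +
          f * (C (Δ ^ j) * p₁ - f ^ j * q) := by
      rw [← hstep, pow_succ, map_mul]
      ring
    rw [heq, map_add, map_mul, map_mul, map_C, map_poleDiv, ← smul_eq_C_mul]
    refine Submodule.add_mem _ (Submodule.smul_mem _ _ ⟨_, rfl⟩) ?_
    have := pow_mul_mem_range_poleDiv hqmem 1
    rwa [pow_one, add_assoc] at this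

end PoleReduction

section DimensionBound

variable {σ K : Type*} [Fintype σ] [Field K]

/-- The forms of degree `s` obtained as `poleDiv F m B` from families `B` of forms, where `F` is a
form of degree `e + 1`. -/
noncomputable def poleDivForms (F : MvPolynomial σ K) (e m s : ℕ) :
    Submodule K (MvPolynomial σ K) :=
  Submodule.span K {p | ∃ b B, b + e = s ∧ (∀ i, (B i).IsHomogeneous b) ∧ poleDiv F m B = p}

lemma poleDiv_mem_poleDivForms {F : MvPolynomial σ K} {e m s b : ℕ} (hb : b + e = s)
    {B : σ → MvPolynomial σ K} (hB : ∀ i, (B i).IsHomogeneous b) :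
    poleDiv F m B ∈ poleDivForms F e m s :=
  Submodule.subset_span ⟨b, B, hb, hB, rfl⟩

lemma mul_mem_poleDivForms {F : MvPolynomial σ K} {e m s : ℕ} (hF : F.IsHomogeneous (e + 1))
    {p : MvPolynomial σ K} (hp : p ∈ poleDivForms F e m s) :
    F * p ∈ poleDivForms F e (m + 1) (s + (e + 1)) := by
  refine (Submodule.span_le (p := (poleDivForms F e (m + 1) (s + (e + 1))).comap
    (LinearMap.mulLeft K F))).2 ?_ hp
  rintro _ ⟨b, B, hb, hB, rfl⟩
  change F * poleDiv F m B ∈ poleDivForms F e (m + 1) (s + (e + 1))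
  rw [mul_poleDiv]
  exact poleDiv_mem_poleDivForms (b := b + (e + 1)) (by omega) fun i => by
    rw [add_comm]; exact hF.mul (hB i)

/-- Griffiths–Dwork reduction: modulo `poleDivForms`, the numerators with pole order `q` are
spanned by a family indexed by the exponents below `e` with the relevant residue of the degree. -/
lemma exists_spanning_mod_poleDivForms [CharZero K] {F : MvPolynomial σ K} {e : ℕ} (he : 0 < e)
    (hF : F.IsHomogeneous (e + 1)) (hσ : 2 ≤ Fintype.card σ) {s₀ : ℕ}
    (h : ContainsForms (Ideal.span (Set.range fun i => pderiv i F)) s₀) (q : ℕ) :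
    ∀ s, s + Fintype.card σ = (q + 1) * (e + 1) →
      ∃ w : (σ → Fin e) → MvPolynomial σ K, ∀ p : MvPolynomial σ K, p.IsHomogeneous s →
        p ∈ poleDivForms F e q s ⊔ Submodule.span K
          (w '' {α | ∃ q' ≤ q, ∑ i, (α i : ℕ) + Fintype.card σ = (q' + 1) * (e + 1)}) := by
  classical
  have hg : ∀ i, (pderiv i F).IsHomogeneous e := fun i => hF.pderiv
  induction q with
  | zero =>
    intro s hs
    obtain ⟨w, hw⟩ := exists_spanning_family he hg h s
    refine ⟨w, fun p hp => Submodule.mem_sup_right ?_⟩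
    obtain ⟨q, hq, hqJ, hpq⟩ := hw p hp
    rw [eq_zero_of_mem_span_range_of_lt hg (by omega) hq hqJ, sub_zero] at hpq
    refine Submodule.span_mono (Set.image_mono ?_) hpq
    rintro α hα
    have hα' : ∑ i, (α i : ℕ) = s := hα
    exact ⟨0, le_rfl, by rw [hα', hs]⟩
  | succ q ih =>
    intro s hs
    obtain ⟨w₁, hw₁⟩ := exists_spanning_family he hg h s
    obtain ⟨w₀, hw₀⟩ : ∃ w₀ : (σ → Fin e) → MvPolynomial σ K, ∀ s', s' + (e + 1) = s →
        ∀ p : MvPolynomial σ K, p.IsHomogeneous s' →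
          p ∈ poleDivForms F e q s' ⊔ Submodule.span K
            (w₀ '' {α | ∃ q' ≤ q, ∑ i, (α i : ℕ) + Fintype.card σ = (q' + 1) * (e + 1)}) := by
      by_cases hse : e + 1 ≤ s
      · obtain ⟨w₀, hw₀⟩ := ih (s - (e + 1)) (by rw [add_mul (q + 1), one_mul] at hs; omega)
        refine ⟨w₀, fun s' hs' => ?_⟩
        rw [show s' = s - (e + 1) by omega]
        exact hw₀
      · exact ⟨0, fun s' hs' => by omega⟩
    refine ⟨fun α => if ∑ i, (α i : ℕ) = s then w₁ α else F * w₀ α, fun p hp => ?_⟩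
    set w : (σ → Fin e) → MvPolynomial σ K :=
      fun α => if ∑ i, (α i : ℕ) = s then w₁ α else F * w₀ α with hw
    set T := {α : σ → Fin e | ∃ q' ≤ q + 1,
      ∑ i, (α i : ℕ) + Fintype.card σ = (q' + 1) * (e + 1)} with hT
    obtain ⟨p₁, hp₁, hp₁J, hpp₁⟩ := hw₁ p hp
    have hspan₁ : Submodule.span K (w₁ '' {α | ∑ i, (α i : ℕ) = s}) ≤
        Submodule.span K (w '' T) := by
      refine Submodule.span_mono ?_
      rintro _ ⟨α, hα, rfl⟩
      have hα' : ∑ i, (α i : ℕ) = s := hα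
      exact ⟨α, ⟨q + 1, le_rfl, by rw [hα', hs]⟩, by simp [hw, hα']⟩
    have hspan₀ : ∀ x ∈ Submodule.span K (w₀ ''
        {α | ∃ q' ≤ q, ∑ i, (α i : ℕ) + Fintype.card σ = (q' + 1) * (e + 1)}),
        F * x ∈ Submodule.span K (w '' T) := by
      intro x hx
      refine (Submodule.span_le (p := (Submodule.span K (w '' T)).comap
        (LinearMap.mulLeft K F))).2 ?_ hx
      rintro _ ⟨α, ⟨q', hq', hα⟩, rfl⟩
      refine Submodule.subset_span ⟨α, ⟨q', by omega, hα⟩, ?_⟩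
      have hne : ∑ i, (α i : ℕ) ≠ s := by
        intro h1
        rw [h1, hs] at hα
        have := Nat.eq_of_mul_eq_mul_right (Nat.succ_pos e) hα
        omega
      simp [hw, hne]
    rw [← sub_add_cancel p p₁]
    refine Submodule.add_mem _ (Submodule.mem_sup_right (hspan₁ hpp₁)) ?_
    by_cases hse : s < e
    · rw [eq_zero_of_mem_span_range_of_lt hg hse hp₁ hp₁J]
      exact Submodule.zero_mem _
    obtain ⟨b, rfl⟩ := Nat.exists_eq_add_of_le (not_lt.1 hse)
    obtain ⟨B, hB, rfl⟩ := exists_isHomogeneous_of_mem_span_range hg hp₁ hp₁J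
    have hq1 : ((q + 1 : ℕ) : K) ≠ 0 := Nat.cast_ne_zero.2 (Nat.succ_ne_zero q)
    have key : ∑ i, B i * pderiv i F =
        F * (((q + 1 : ℕ) : K)⁻¹ • ∑ i, pderiv i (B i)) -
          ((q + 1 : ℕ) : K)⁻¹ • poleDiv F (q + 1) B := by
      rw [poleDiv_eq_sub, smul_sub, mul_smul_comm, sub_sub_cancel, ← map_natCast C,
        ← smul_eq_C_mul, smul_smul, inv_mul_cancel₀ hq1, one_smul]
    rw [key]
    refine Submodule.sub_mem _ ?_ (Submodule.smul_mem _ _ (Submodule.mem_sup_left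
      (poleDiv_mem_poleDivForms (add_comm b e) hB)))
    rcases Nat.eq_zero_or_pos b with rfl | hb
    · have hz : ∀ i, pderiv i (B i) = 0 := fun i => by
        rw [totalDegree_eq_zero_iff_eq_C.1 ((totalDegree_zero_iff_isHomogeneous σ).2 (hB i))]
        exact pderiv_C
      simp [hz]
    · have hdiv : (((q + 1 : ℕ) : K)⁻¹ • ∑ i, pderiv i (B i)).IsHomogeneous (b - 1) :=
        (homogeneousSubmodule σ K (b - 1)).smul_mem _
          (IsHomogeneous.sum _ _ _ fun i _ => (hB i).pderiv)
      obtain ⟨y, hy, z, hz, hyz⟩ := Submodule.mem_sup.1 (hw₀ (b - 1) (by omega) _ hdiv)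
      rw [← hyz, mul_add]
      refine Submodule.add_mem _ (Submodule.mem_sup_left ?_)
        (Submodule.mem_sup_right (hspan₀ z hz))
      have := mul_mem_poleDivForms hF hy
      rwa [show b - 1 + (e + 1) = e + b by omega] at this

lemma card_exponents_le (n e : ℕ) (T : Finset (Fin (n + 1) → Fin e))
    (hT : ∀ α ∈ T, ∃ q, ∑ i, (α i : ℕ) + (n + 1) = (q + 1) * (e + 1)) :
    T.card ≤ e ^ n := by
  have hinj : Set.InjOn (fun (α : Fin (n + 1) → Fin e) (i : Fin n) => α i.succ) T := by
    intro α hα β hβ hαβ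
    obtain ⟨q, hq⟩ := hT α hα
    obtain ⟨q', hq'⟩ := hT β hβ
    have hs : ∀ i : Fin n, α i.succ = β i.succ := fun i => congrFun hαβ i
    rw [Fin.sum_univ_succ] at hq hq'
    simp only [hs] at hq
    have h0 : α 0 = β 0 := by
      have ha := (α 0).2
      have hb := (β 0).2
      set c := ∑ i : Fin n, (β i.succ : ℕ)
      have hmod : ((α 0 : ℕ) + (c + (n + 1))) ≡ ((β 0 : ℕ) + (c + (n + 1))) [MOD (e + 1)] := by
        rw [← add_assoc, ← add_assoc, ← add_assoc, ← add_assoc]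
        have h1 : (α 0 : ℕ) + c + (n + 1) ≡ 0 [MOD (e + 1)] := by
          rw [hq]; exact (Nat.modEq_zero_iff_dvd).2 ⟨_, mul_comm _ _⟩
        have h2 : (β 0 : ℕ) + c + (n + 1) ≡ 0 [MOD (e + 1)] := by
          rw [hq']; exact (Nat.modEq_zero_iff_dvd).2 ⟨_, mul_comm _ _⟩
        simpa only [add_assoc] using h1.trans h2.symm
      exact Fin.ext (Nat.ModEq.eq_of_lt_of_lt (Nat.ModEq.add_right_cancel' _ hmod)
        (by omega) (by omega))
    funext i
    refine Fin.cases h0 hs i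
  calc T.card = (T.image fun (α : Fin (n + 1) → Fin e) (i : Fin n) => α i.succ).card :=
        (Finset.card_image_of_injOn hinj).symm
    _ ≤ Fintype.card (Fin n → Fin e) := Finset.card_le_univ _
    _ = e ^ n := by simp

lemma exists_relation_mod_poleDivForms [CharZero K] {n e : ℕ} (hn : 1 ≤ n) (he : 0 < e)
    {F : MvPolynomial (Fin (n + 1)) K} (hF : F.IsHomogeneous (e + 1)) {s₀ : ℕ}
    (h : ContainsForms (Ideal.span (Set.range fun i => pderiv i F)) s₀) {q s r : ℕ}
    (hs : s + (n + 1) = (q + 1) * (e + 1)) (hr : e ^ n ≤ r)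
    {p : Fin (r + 1) → MvPolynomial (Fin (n + 1)) K} (hp : ∀ j, (p j).IsHomogeneous s) :
    ∃ x : Fin (r + 1) → K, x ≠ 0 ∧ ∑ j, x j • p j ∈ poleDivForms F e q s := by
  classical
  obtain ⟨w, hw⟩ := exists_spanning_mod_poleDivForms he hF (by simpa using hn) h q s (by simpa using hs)
  set E := poleDivForms F e q s
  let T : Finset (Fin (n + 1) → Fin e) := Finset.univ.filter fun α =>
    ∃ q' ≤ q, ∑ i, (α i : ℕ) + Fintype.card (Fin (n + 1)) = (q' + 1) * (e + 1)
  have hT : T.card ≤ e ^ n := card_exponents_le n e T fun α hα => by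
    obtain ⟨q', -, hq'⟩ := (Finset.mem_filter.1 hα).2
    exact ⟨q', by simpa using hq'⟩
  have hdep : ¬ LinearIndependent K fun j => E.mkQ (p j) := by
    intro hli
    have hle : Submodule.span K (Set.range fun j => E.mkQ (p j)) ≤
        Submodule.span K ((T.image fun α => E.mkQ (w α) : Finset _) : Set _) := by
      refine Submodule.span_le.2 ?_
      rintro _ ⟨j, rfl⟩
      obtain ⟨y, hy, z, hz, hyz⟩ := Submodule.mem_sup.1 (hw _ (hp j))
      have h1 : E.mkQ (p j) = E.mkQ z := by
        rw [← hyz, map_add, show E.mkQ y = 0 from (Submodule.Quotient.mk_eq_zero _).2 hy, zero_add]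
      change E.mkQ (p j) ∈ _
      rw [h1]
      have h2 := Submodule.mem_map_of_mem (f := E.mkQ) hz
      rw [Submodule.map_span, Set.image_image] at h2
      refine Submodule.span_mono ?_ h2
      rintro _ ⟨α, hα, rfl⟩
      exact Finset.mem_coe.2 (Finset.mem_image_of_mem _ (Finset.mem_filter.2 ⟨Finset.mem_univ _, hα⟩))
    have h3 := Submodule.finrank_mono hle
    rw [finrank_span_eq_card hli, Fintype.card_fin] at h3
    have h4 := (finrank_span_finset_le_card (R := K) (T.image fun α => E.mkQ (w α))).trans
      Finset.card_image_le
    rw [Set.finrank] at h4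
    omega
  obtain ⟨x, hx, i, hi⟩ := Fintype.not_linearIndependent_iff.1 hdep
  refine ⟨x, fun h0 => hi (by rw [h0, Pi.zero_apply]), ?_⟩
  rw [← Submodule.Quotient.mk_eq_zero, ← Submodule.mkQ_apply, map_sum, ← hx]
  simp

end DimensionBound

section MonomialColumns

variable {σ R : Type*} [Fintype σ] [CommRing R]

lemma isHomogeneous_poleDiv {F : MvPolynomial σ R} {e b m : ℕ} (hF : F.IsHomogeneous (e + 1))
    (hb : 1 ≤ b) {B : σ → MvPolynomial σ R} (hB : ∀ i, (B i).IsHomogeneous b) :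
    (poleDiv F m B).IsHomogeneous (e + b) := by
  rw [poleDiv_apply]
  refine IsHomogeneous.sum _ _ _ fun i _ => IsHomogeneous.sub ?_ ?_
  · rw [show e + b = e + 1 + (b - 1) by omega]
    exact hF.mul (hB i).pderiv
  · have h := ((isHomogeneous_C σ (m : R)).mul (hB i)).mul (hF.pderiv (i := i))
    rwa [map_natCast, show 0 + b + (e + 1 - 1) = e + b by omega] at h

lemma degT_poleDiv_le {f : MvPolynomial σ (Polynomial R)} {m M N : ℕ} (hf : degT f ≤ M)
    {B : σ → MvPolynomial σ (Polynomial R)} (hB : ∀ i, degT (B i) ≤ N) :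
    degT (poleDiv f m B) ≤ M + N := by
  rw [poleDiv_apply]
  refine degT_sum_le _ fun i _ => degT_sub_le (degT_mul_le hf (degT_pderiv_le (hB i) i)) ?_
  rw [add_comm]
  exact degT_mul_le (degT_natCast_mul_le m (hB i)) (degT_pderiv_le hf i)

lemma poleDivForms_le_span [DecidableEq σ] {K : Type*} [Field K] (F : MvPolynomial σ K)
    (e m t : ℕ) :
    poleDivForms F e m (e + t) ≤ Submodule.span K (Set.range
      fun i : {α : σ →₀ ℕ // α.degree = t} × σ =>
        poleDiv F m (Pi.single i.2 (monomial i.1.1 1))) := by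
  refine Submodule.span_le.2 ?_
  rintro _ ⟨b, B, hb, hB, rfl⟩
  obtain rfl : b = t := by omega
  rw [SetLike.mem_coe, ← Finset.univ_sum_single B, map_sum]
  refine Submodule.sum_mem _ fun i _ => ?_
  have hi : (Pi.single i (B i) : σ → MvPolynomial σ K) =
      ∑ α ∈ (B i).support, (B i).coeff α • Pi.single i (monomial α 1) := by
    conv_lhs => rw [(B i).as_sum]
    rw [← LinearMap.coe_single K (fun _ : σ => MvPolynomial σ K) i, map_sum]
    refine Finset.sum_congr rfl fun α _ => ?_
    rw [← map_smul, smul_monomial, smul_eq_mul, mul_one]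
  rw [hi, map_sum]
  refine Submodule.sum_mem _ fun α hα => ?_
  rw [map_smul]
  exact Submodule.smul_mem _ _ (Submodule.subset_span
    ⟨(⟨α, ((hB i).degree_eq_sum_deg_support hα).symm⟩, i), rfl⟩)

lemma map_single_monomial {τ : Type*} [DecidableEq τ] {S : Type*} [CommRing S] (φ : R →+* S) (i : τ)
    (α : τ →₀ ℕ) :
    (fun j => map φ ((Pi.single i (monomial α 1) : τ → MvPolynomial τ R) j)) =
      Pi.single i (monomial α 1) := by
  funext j
  by_cases h : j = i
  · subst h; simp
  · simp [h]

lemma finrank_homogeneousSubmodule_le_choose {K : Type*} [Field K] (n s : ℕ) :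
    Module.finrank K (homogeneousSubmodule (Fin (n + 1)) K s) ≤ (n + s).choose n := by
  classical
  let T := (Finset.univ : Finset (Fin (n + 1))).finsuppAntidiag s
  have hle : homogeneousSubmodule (Fin (n + 1)) K s ≤
      Submodule.span K ((T.image fun m => monomial m (1 : K) : Finset _) : Set _) := by
    intro p hp
    rw [p.as_sum]
    refine Submodule.sum_mem _ fun m hm => ?_
    rw [show monomial m (coeff m p) = coeff m p • monomial m (1 : K) by
      rw [smul_monomial, smul_eq_mul, mul_one]]
    refine Submodule.smul_mem _ _ (Submodule.subset_span
      (Finset.mem_coe.2 (Finset.mem_image_of_mem _ ?_)))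
    refine Finset.mem_finsuppAntidiag.2 ⟨?_, Finset.subset_univ _⟩
    rw [← Finsupp.degree_eq_sum]
    exact (hp.degree_eq_sum_deg_support hm).symm
  calc _ ≤ _ := Submodule.finrank_mono hle
    _ ≤ T.card := (finrank_span_finset_le_card _).trans Finset.card_image_le
    _ = (n + s).choose n := by
      rw [Finset.card_finsuppAntidiag_nat_eq_choose, Finset.card_univ, Fintype.card_fin,
        show n + 1 + s - 1 = n + s by omega, Nat.choose_symm_add]

end MonomialColumns

section Estimates

lemma add_one_pow_le_exp_mul_factorial (n : ℕ) :
    ((n : ℝ) + 1) ^ n ≤ Real.exp 1 ^ n * n.factorial := by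
  induction n with
  | zero => simp
  | succ n ih =>
    have hpos : (0 : ℝ) < (n : ℝ) + 1 := by positivity
    have h1 : ((n : ℝ) + 1 + 1) ^ (n + 1) ≤ ((n : ℝ) + 1) ^ (n + 1) * Real.exp 1 := by
      have h2 : (n : ℝ) + 1 + 1 ≤ (n + 1) * Real.exp (1 / ((n : ℝ) + 1)) := by
        calc (n : ℝ) + 1 + 1 = (n + 1) * (1 / ((n : ℝ) + 1) + 1) := by field_simp; ring
          _ ≤ _ := mul_le_mul_of_nonneg_left (Real.add_one_le_exp _) hpos.le
      calc ((n : ℝ) + 1 + 1) ^ (n + 1) ≤ ((n + 1) * Real.exp (1 / ((n : ℝ) + 1))) ^ (n + 1) :=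
            pow_le_pow_left₀ (by positivity) h2 _
        _ = _ := by
            rw [mul_pow, ← Real.exp_nat_mul]
            congr 2
            push_cast
            field_simp
    rw [Nat.factorial_succ]
    push_cast
    calc ((n : ℝ) + 1 + 1) ^ (n + 1) ≤ ((n : ℝ) + 1) ^ (n + 1) * Real.exp 1 := h1
      _ = ((n : ℝ) + 1) ^ n * ((n + 1) * Real.exp 1) := by ring
      _ ≤ (Real.exp 1 ^ n * n.factorial) * ((n + 1) * Real.exp 1) :=
          mul_le_mul_of_nonneg_right ih (by positivity)
      _ = _ := by ring

lemma choose_le_exp_mul_pow (n e : ℕ) :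
    ((n + (n + 1) * e).choose n : ℝ) ≤ Real.exp 1 ^ n * ((e : ℝ) + 1) ^ n := by
  have h1 : ((n + (n + 1) * e).choose n : ℝ) ≤ ((n + (n + 1) * e : ℕ) : ℝ) ^ n / n.factorial :=
    Nat.choose_le_pow_div _ _
  have hfac : (0 : ℝ) < n.factorial := by exact_mod_cast n.factorial_pos
  refine h1.trans ((div_le_iff₀ hfac).2 ?_)
  calc ((n + (n + 1) * e : ℕ) : ℝ) ^ n ≤ (((n : ℝ) + 1) * (e + 1)) ^ n :=
        pow_le_pow_left₀ (by positivity) (by push_cast; nlinarith) _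
    _ = ((n : ℝ) + 1) ^ n * ((e : ℝ) + 1) ^ n := mul_pow _ _ _
    _ ≤ (Real.exp 1 ^ n * n.factorial) * ((e : ℝ) + 1) ^ n :=
        mul_le_mul_of_nonneg_right (add_one_pow_le_exp_mul_factorial n) (by positivity)
    _ = _ := by ring

/-- Comparison of the degree bound given by linear algebra with the stated one. -/
lemma degree_estimate {n r u N : ℕ} {D α δ : ℝ} (hn : 1 ≤ n) (hr : 1 ≤ r)
    (hND : (N : ℝ) ≤ D) (hrD : (r : ℝ) ≤ D) (hδ : 0 ≤ δ) :
    N * δ + r * (α + r * δ + u * (N * δ)) ≤ r * α + r * (n + u + 1) * D * δ := by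
  have hr' : (1 : ℝ) ≤ r := by exact_mod_cast hr
  have hn' : (1 : ℝ) ≤ n := by exact_mod_cast hn
  have hu : (0 : ℝ) ≤ u := Nat.cast_nonneg u
  have hD : 0 ≤ D := by linarith
  have h1 : (r : ℝ) * r ≤ r * D := mul_le_mul_of_nonneg_left hrD (by linarith)
  have h2 : (r : ℝ) * u * N ≤ r * u * D := mul_le_mul_of_nonneg_left hND (by positivity)
  have h3 : D ≤ r * n * D := le_mul_of_one_le_left hD (by nlinarith)
  have h4 : N + r * r + r * u * N ≤ r * (n + u + 1) * D := by nlinarith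
  have h5 := mul_le_mul_of_nonneg_right h4 hδ
  nlinarith

end Estimates

section Assembly

variable {σ k : Type*} [Fintype σ] [Field k]

/-- Forms over `k[t]` dependent modulo `poleDivForms` satisfy such a relation with polynomial
coefficients of controlled degree. -/
lemma exists_relation_mod_range_poleDiv {f : MvPolynomial σ (Polynomial k)} {e t m r α N : ℕ}
    (hf : f.IsHomogeneous (e + 1)) (ht : 1 ≤ t)
    (hN : Module.finrank (RatFunc k) (homogeneousSubmodule σ (RatFunc k) (e + t)) ≤ N)
    {q : Fin (r + 1) → MvPolynomial σ (Polynomial k)} (hq : ∀ j, degT (q j) ≤ α)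
    {x : Fin (r + 1) → RatFunc k} (hx0 : x ≠ 0)
    (hx : ∑ j, x j • map (algebraMap (Polynomial k) (RatFunc k)) (q j) ∈
      poleDivForms (map (algebraMap (Polynomial k) (RatFunc k)) f) e m (e + t)) :
    ∃ c : Fin (r + 1) → Polynomial k, c ≠ 0 ∧
      (∀ j, (c j).natDegree ≤ N * degT f + r * α) ∧
      map (algebraMap (Polynomial k) (RatFunc k)) (∑ j, C (c j) * q j) ∈
        LinearMap.range (poleDiv (map (algebraMap (Polynomial k) (RatFunc k)) f) m) := by
  classical
  have : Finite {α : σ →₀ ℕ // α.degree = t} := Finsupp.finite_of_degree_eq t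
  let _ : Fintype {α : σ →₀ ℕ // α.degree = t} := Fintype.ofFinite _
  let col : {α : σ →₀ ℕ // α.degree = t} × σ → MvPolynomial σ (Polynomial k) := fun i =>
    poleDiv f m (Pi.single i.2 (monomial i.1.1 1))
  have hcolφ : ∀ i, map (algebraMap (Polynomial k) (RatFunc k)) (col i) =
      poleDiv (map (algebraMap (Polynomial k) (RatFunc k)) f) m
        (Pi.single i.2 (monomial i.1.1 1)) :=
    fun i => by rw [map_poleDiv, map_single_monomial]
  have hcolδ : ∀ i, degT (col i) ≤ degT f := by
    intro i
    refine degT_poleDiv_le (N := 0) le_rfl fun j => ?_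
    by_cases h : j = i.2
    · rw [h, Pi.single_eq_same]
      simpa using degT_monomial_le (R := k) i.1.1 1
    · rw [Pi.single_eq_of_ne h]
      simp [degT]
  have hcolh : ∀ i, (map (algebraMap (Polynomial k) (RatFunc k)) (col i)).IsHomogeneous
      (e + t) := by
    intro i
    rw [hcolφ]
    refine isHomogeneous_poleDiv (hf.map _) ht fun j => ?_
    by_cases h : j = i.2
    · rw [h, Pi.single_eq_same]
      exact isHomogeneous_monomial _ i.1.2
    · rw [Pi.single_eq_of_ne h]
      exact isHomogeneous_zero _ _ _
  obtain ⟨c, hc0, hcd, hcm⟩ := exists_relation_natDegree_le col q hcolδ hq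
    (card_le_of_linearIndepOn_isHomogeneous hN hcolh) hx0 (by
      simp only [hcolφ]
      exact poleDivForms_le_span _ e m t hx)
  refine ⟨c, hc0, hcd, Submodule.span_le.2 ?_ hcm⟩
  rintro _ ⟨i, rfl⟩
  exact ⟨_, (hcolφ i).symm⟩

lemma map_sum_mem_range_poleDiv {ι : Type*} [Fintype ι] {f : MvPolynomial σ (Polynomial k)}
    {m u : ℕ} {Δ : Polynomial k} (hΔ : Δ ≠ 0) {p q : ι → MvPolynomial σ (Polynomial k)}
    (hpq : ∀ j, map (algebraMap (Polynomial k) (RatFunc k)) (C (Δ ^ u) * p j - f ^ u * q j) ∈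
      LinearMap.range (poleDiv (map (algebraMap (Polynomial k) (RatFunc k)) f) (m + u)))
    {c : ι → Polynomial k}
    (hc : map (algebraMap (Polynomial k) (RatFunc k)) (∑ j, C (c j) * q j) ∈
      LinearMap.range (poleDiv (map (algebraMap (Polynomial k) (RatFunc k)) f) m)) :
    map (algebraMap (Polynomial k) (RatFunc k)) (∑ j, C (c j) * p j) ∈
      LinearMap.range (poleDiv (map (algebraMap (Polynomial k) (RatFunc k)) f) (m + u)) := by
  have heq : C (Δ ^ u) * ∑ j, C (c j) * p j =
      ∑ j, C (c j) * (C (Δ ^ u) * p j - f ^ u * q j) + f ^ u * ∑ j, C (c j) * q j := by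
    rw [Finset.mul_sum, Finset.mul_sum, ← Finset.sum_add_distrib]
    exact Finset.sum_congr rfl fun j _ => by ring
  have h1 : map (algebraMap (Polynomial k) (RatFunc k)) (C (Δ ^ u) * ∑ j, C (c j) * p j) ∈
      LinearMap.range (poleDiv (map (algebraMap (Polynomial k) (RatFunc k)) f) (m + u)) := by
    rw [heq, map_add]
    refine Submodule.add_mem _ ?_ ?_
    · rw [map_sum]
      refine Submodule.sum_mem _ fun j _ => ?_
      rw [map_mul, map_C, ← smul_eq_C_mul]
      exact Submodule.smul_mem _ _ (hpq j)
    · rw [map_mul, map_pow]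
      exact pow_mul_mem_range_poleDiv hc u
  rw [map_mul, map_C, ← smul_eq_C_mul] at h1
  refine (Submodule.smul_mem_iff _ ?_).1 h1
  rw [map_pow]
  exact pow_ne_zero _
    ((map_ne_zero_iff _ (IsFractionRing.injective (Polynomial k) (RatFunc k))).2 hΔ)

end Assembly

/-- Existence of a telescoper with regular certificate of order `r ≤ d^n` whose
coefficients satisfy `deg_t c_i ≤ r·deg_t a + (r² + r·ℓ)·eⁿ·dⁿ·deg_t f`. -/
theorem telescoper_degree_bound {k : Type*} [Field k] [CharZero k]
    (n : ℕ) (hn : 1 ≤ n) (d : ℕ) (hd : 2 ≤ d) (ℓ : ℕ) (hℓ : 1 ≤ ℓ)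
    (f a : MvPolynomial (Fin (n + 1)) (Polynomial k))
    (hf : f.IsHomogeneous d)
    (hadeg : n + 1 ≤ ℓ * d) (ha : a.IsHomogeneous (ℓ * d - (n + 1)))
    (hH : Module.Finite (RatFunc k)
      (MvPolynomial (Fin (n + 1)) (RatFunc k) ⧸
        Ideal.span (Set.range fun i : Fin (n + 1) =>
          pderiv i (MvPolynomial.map (algebraMap (Polynomial k) (RatFunc k)) f)))) :
    ∃ r ≤ d ^ n, ∃ c : ℕ → Polynomial k, (∃ j ≤ r, c j ≠ 0) ∧
      (∀ i ≤ r, ((c i).natDegree : ℝ) ≤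
        r * (degT a : ℝ)
          + ((r : ℝ) ^ 2 + (r : ℝ) * ℓ) * Real.exp 1 ^ n * (d : ℝ) ^ n * (degT f : ℝ)) ∧
      ∃ (m : ℕ) (B : Fin (n + 1) → MvPolynomial (Fin (n + 1)) (RatFunc k)),
        MvPolynomial.map (algebraMap (Polynomial k) (RatFunc k))
            ((∑ j ∈ Finset.range (r + 1),
                MvPolynomial.C (c j) * telSeq dtMv f a ℓ j * f ^ (r - j)) * f ^ (m + 1))
          = (MvPolynomial.map (algebraMap (Polynomial k) (RatFunc k)) f) ^ (ℓ + r) *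
              ∑ i : Fin (n + 1),
                (MvPolynomial.map (algebraMap (Polynomial k) (RatFunc k)) f * pderiv i (B i)
                  - (m : MvPolynomial (Fin (n + 1)) (RatFunc k)) * B i *
                      pderiv i (MvPolynomial.map (algebraMap (Polynomial k) (RatFunc k)) f)) := by
  classical
  obtain ⟨e, rfl⟩ : ∃ e, d = e + 1 := ⟨d - 1, by omega⟩
  set φ := algebraMap (Polynomial k) (RatFunc k) with hφ
  have he : 0 < e := by omega
  have hF : (map φ f).IsHomogeneous (e + 1) := hf.map φ
  have hg : ∀ i, (pderiv i (map φ f)).IsHomogeneous e := fun i => hF.pderiv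
  obtain ⟨s₀, hs₀⟩ := exists_containsForms_of_finite (isGradedIdeal_span (e := e) (by
    rintro _ ⟨i, rfl⟩
    exact hg i)) hH
  set t := n * e with ht
  have hD : e + t = (n + 1) * e := by rw [ht]; ring
  have ht1 : 1 ≤ t := Nat.mul_pos hn he
  have hcont : ContainsForms (Ideal.span (Set.range fun i => pderiv i (map φ f))) (e + t) := by
    refine containsForms_of_lt he hg hs₀ ?_
    rw [Fintype.card_fin, hD]
    exact Nat.mul_lt_mul_of_pos_left (by omega) (Nat.succ_pos n)
  set N := (n + (n + 1) * e).choose n with hN_def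
  have hN : Module.finrank (RatFunc k) (homogeneousSubmodule (Fin (n + 1)) (RatFunc k) (e + t)) ≤ N := by
    rw [hD]
    exact finrank_homogeneousSubmodule_le_choose n _
  set δ := degT f with hδ
  obtain ⟨Δ, hΔ0, hΔ⟩ := exists_mul_eq_sum (g := fun i => pderiv i f) (e := e) (δ := δ) (fun i => hf.pderiv)
    (fun i => degT_pderiv_le le_rfl i) hN (by simpa only [pderiv_map] using hcont)
  set r := (e + 1) ^ n with hr
  have hrn : n + 1 ≤ r := Nat.lt_pow_self (by omega)
  obtain ⟨u, hu⟩ : ∃ u, ℓ + r = n + u + 1 := ⟨ℓ + r - (n + 1), by omega⟩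
  have hPh : ∀ j : Fin (r + 1), (telSeq dtMv f a ℓ j * f ^ (r - j)).IsHomogeneous
      (e + t + u * (e + 1)) := by
    intro j
    have h1 := (isHomogeneous_telSeq hf ha ℓ j).mul (hf.pow (r - j))
    convert h1 using 1
    have hj : (j : ℕ) + (r - j) = r := by omega
    have h2 : ℓ * (e + 1) - (n + 1) + j * (e + 1) + (e + 1) * (r - j) + (n + 1) =
        (ℓ + r) * (e + 1) := by
      calc _ = (ℓ * (e + 1) - (n + 1) + (n + 1)) + (j + (r - j)) * (e + 1) := by ring
        _ = _ := by rw [Nat.sub_add_cancel hadeg, hj]; ring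
    have h3 : e + t + u * (e + 1) + (n + 1) = (ℓ + r) * (e + 1) := by rw [hu, hD]; ring
    omega
  have hPd : ∀ j : Fin (r + 1), degT (telSeq dtMv f a ℓ j * f ^ (r - j)) ≤ degT a + r * δ := by
    intro j
    refine (degT_mul_le (degT_telSeq_le f a ℓ j) (degT_pow_le le_rfl (r - j))).trans_eq ?_
    rw [add_assoc, ← add_mul, show (j : ℕ) + (r - j) = r by omega]
  choose q hqh hqd hqm using fun j => exists_pole_reduction (n := n) hΔ u _ _ (hPh j) (hPd j)
  obtain ⟨x, hx0, hx⟩ := exists_relation_mod_poleDivForms hn he hF hcont (q := n) (s := e + t)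
    (r := r) (by rw [hD]; ring) (Nat.pow_le_pow_left (by omega) n) fun j => (hqh j).map φ
  obtain ⟨c, hc0, hcd, hcr⟩ := exists_relation_mod_range_poleDiv hf ht1 hN hqd hx0 hx
  set S := ∑ j : Fin (r + 1), C (c j) * (telSeq dtMv f a ℓ j * f ^ (r - j)) with hS
  obtain ⟨B, hB⟩ : map φ S ∈ LinearMap.range (poleDiv (map φ f) (n + u)) :=
    map_sum_mem_range_poleDiv hΔ0 hqm hcr
  let c' : ℕ → Polynomial k := fun j => if h : j < r + 1 then c ⟨j, h⟩ else 0
  have hc' : ∀ j : Fin (r + 1), c' j = c j := fun j => dif_pos j.2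
  refine ⟨r, le_rfl, c', ?_, fun i hi => ?_, n + u, B, ?_⟩
  · obtain ⟨j, hj⟩ := Function.ne_iff.1 hc0
    exact ⟨j, by omega, by rwa [hc']⟩
  · have h1 : (c' i).natDegree ≤ _ := (hc' ⟨i, by omega⟩).symm ▸ hcd ⟨i, by omega⟩
    have h2 : ((c' i).natDegree : ℝ) ≤
        N * δ + r * (degT a + r * δ + u * (N * δ)) := by exact_mod_cast h1
    have hrD : (r : ℝ) ≤ Real.exp 1 ^ n * ((e : ℝ) + 1) ^ n := by
      rw [hr]
      push_cast
      exact le_mul_of_one_le_left (by positivity) (one_le_pow₀ (Real.one_le_exp zero_le_one))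
    refine h2.trans ((degree_estimate hn (by omega) (choose_le_exp_mul_pow n e) hrD
      (Nat.cast_nonneg δ)).trans_eq ?_)
    have hu' : (ℓ : ℝ) + r = n + u + 1 := by exact_mod_cast hu
    rw [← hu']
    push_cast
    ring
  · have hsum : ∑ j ∈ Finset.range (r + 1), C (c' j) * telSeq dtMv f a ℓ j * f ^ (r - j) = S := by
      rw [Finset.sum_range, hS]
      exact Finset.sum_congr rfl fun j _ => by rw [hc', mul_assoc]
    rw [hsum, map_mul, map_pow, ← hB, hu, mul_comm, poleDiv_apply]
end

section
/- Let k be a field and let M be a nonzero p×q matrix with entries in k[t], all of degree at most δ, whose rank over the fraction field k(t) is r ≥ 1. Then there exist a nonzero polynomial E ∈ k[t] with deg E ≤ r·δ and a q×p matrix N with entries in k[t] of degree at most (r−1)·δ such that M·N·M = E·M. (The matrix N/E is a split of M, obtained from the adjugate of a maximal-rank minor via Cramer's rule and Hadamard's bound.) -/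
open Polynomial

namespace Matrix

/-- The rows of a matrix of rank `r` over a field are combinations of some `r` of them. -/
theorem exists_eq_mul_submatrix_rows {K m n : Type*} [Field K] [Finite m] [Fintype n]
    (A : Matrix m n K) {r : ℕ} (hA : A.rank = r) :
    ∃ (f : Fin r → m) (C : Matrix m (Fin r) K), A = C * A.submatrix f id := by
  rw [rank_eq_finrank_span_row] at hA
  subst hA
  obtain ⟨v, hv, hspan, -⟩ := Submodule.exists_fun_fin_finrank_span_eq K (Set.range A.row)
  choose f hf using hv
  have hmem (i : m) : ∃ c : Fin _ → K, ∑ a, c a • v a = A.row i := by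
    rw [← Submodule.mem_span_range_iff_exists_fun, hspan]
    exact Submodule.subset_span ⟨i, rfl⟩
  choose C hC using hmem
  refine ⟨f, of C, ?_⟩
  ext i j
  have h := congrFun (hC i) j
  simp only [← hf, Finset.sum_apply, Pi.smul_apply, smul_eq_mul, row_apply] at h
  simp [mul_apply, h]

/-- The columns of a matrix of rank `r` over a field are combinations of some `r` of them. -/
theorem exists_eq_submatrix_cols_mul {K m n : Type*} [Field K] [Fintype m] [Fintype n]
    (A : Matrix m n K) {r : ℕ} (hA : A.rank = r) :
    ∃ (g : Fin r → n) (D : Matrix (Fin r) n K), A = A.submatrix id g * D := by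
  obtain ⟨g, C, hC⟩ := Aᵀ.exists_eq_mul_submatrix_rows ((rank_transpose A).trans hA)
  refine ⟨g, Cᵀ, ?_⟩
  simpa [transpose_mul, transpose_submatrix] using congrArg transpose hC

/-- A matrix of rank `r` over a field has an invertible `r × r` submatrix, and the adjugate of that
submatrix is a generalized inverse up to the factor given by its determinant. -/
theorem exists_submatrix_adjugate_split {K m n : Type*} [Field K] [Fintype m] [Fintype n]
    (A : Matrix m n K) {r : ℕ} (hA : A.rank = r) :
    ∃ (f : Fin r → m) (g : Fin r → n), (A.submatrix f g).det ≠ 0 ∧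
      A.submatrix id g * (A.submatrix f g).adjugate * A.submatrix f id =
        (A.submatrix f g).det • A := by
  obtain ⟨f, C, hC⟩ := A.exists_eq_mul_submatrix_rows hA
  obtain ⟨g, D, hD⟩ := A.exists_eq_submatrix_cols_mul hA
  have hcols : A.submatrix id g = C * A.submatrix f g := by
    conv_lhs => rw [hC]
    rfl
  have hrows : A.submatrix f id = A.submatrix f g * D := by
    conv_lhs => rw [hD]
    rfl
  refine ⟨f, g, ?_, ?_⟩
  · rw [← isUnit_iff_ne_zero, ← isUnit_iff_isUnit_det, ← linearIndependent_rows_iff_isUnit,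
      linearIndependent_iff_card_eq_finrank_span, Set.finrank, ← rank_eq_finrank_span_row,
      Fintype.card_fin]
    refine le_antisymm ?_ (rank_le_height _)
    refine hA.symm.le.trans ?_
    conv_lhs => rw [hC, hrows]
    exact (rank_mul_le_right _ _).trans (rank_mul_le_left _ _)
  · calc A.submatrix id g * (A.submatrix f g).adjugate * A.submatrix f id
        = C * (A.submatrix f g * (A.submatrix f g).adjugate) * A.submatrix f id := by
          rw [hcols, Matrix.mul_assoc C]
      _ = (A.submatrix f g).det • (C * A.submatrix f id) := by
          rw [mul_adjugate, Matrix.mul_smul, Matrix.mul_one, Matrix.smul_mul]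
      _ = (A.submatrix f g).det • A := by rw [← hC]

theorem natDegree_det_le_card_mul {R n : Type*} [CommRing R] [Fintype n] [DecidableEq n]
    (A : Matrix n n R[X]) {d : ℕ} (hA : ∀ i j, (A i j).natDegree ≤ d) :
    A.det.natDegree ≤ Fintype.card n * d := by
  rw [det_apply]
  refine natDegree_sum_le_of_forall_le _ _ fun σ _ => ?_
  refine (natDegree_smul_le _ _).trans ((natDegree_prod_le _ _).trans ?_)
  simpa using Finset.sum_le_card_nsmul Finset.univ _ d fun i _ => hA (σ i) i

theorem natDegree_adjugate_le {R : Type*} [CommRing R] {r : ℕ}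
    (A : Matrix (Fin r) (Fin r) R[X]) {d : ℕ} (hA : ∀ i j, (A i j).natDegree ≤ d) (i j : Fin r) :
    (A.adjugate i j).natDegree ≤ (r - 1) * d := by
  cases r with
  | zero => exact i.elim0
  | succ r =>
    rw [adjugate_fin_succ_eq_det_submatrix]
    have hdet := (A.submatrix j.succAbove i.succAbove).natDegree_det_le_card_mul
      fun a b => hA (j.succAbove a) (i.succAbove b)
    rw [Fintype.card_fin] at hdet
    rcases neg_one_pow_eq_or R[X] (j + i : ℕ) with h | h <;> simpa [h] using hdet

end Matrix

/-- Split of a polynomial matrix via Cramer's rule and Hadamard's bound: if `M` is a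
nonzero `p×q` matrix over `k[t]` with entries of degree at most `δ` and rank `r ≥ 1`
over `k(t)`, then there are `E ∈ k[t]`, `E ≠ 0`, `deg E ≤ r·δ`, and a `q×p` matrix `N`
over `k[t]` with entries of degree at most `(r−1)·δ` such that `M·N·M = E·M`. -/
theorem matrix_split_exists {k : Type*} [Field k] (p q δ r : ℕ)
    (M : Matrix (Fin p) (Fin q) (Polynomial k)) (hM : M ≠ 0)
    (hdeg : ∀ i j, (M i j).natDegree ≤ δ)
    (hr : 1 ≤ r)
    (hrank : (M.map (algebraMap (Polynomial k) (RatFunc k))).rank = r) :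
    ∃ E : Polynomial k, E ≠ 0 ∧ E.natDegree ≤ r * δ ∧
      ∃ N : Matrix (Fin q) (Fin p) (Polynomial k),
        (∀ i j, (N i j).natDegree ≤ (r - 1) * δ) ∧ M * N * M = E • M := by
  obtain ⟨f, g, hdet, hsplit⟩ := Matrix.exists_submatrix_adjugate_split _ hrank
  have hinj : Function.Injective (algebraMap k[X] (RatFunc k)) :=
    IsFractionRing.injective k[X] (RatFunc k)
  set φ := algebraMap k[X] (RatFunc k)
  set S := M.submatrix f g
  have hS : (M.map φ).submatrix f g = φ.mapMatrix S := rfl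
  rw [hS, ← RingHom.map_det] at hdet hsplit
  rw [← RingHom.map_adjugate] at hsplit
  have hSdeg : ∀ a b, (S a b).natDegree ≤ δ := fun a b => hdeg (f a) (g b)
  refine ⟨S.det, fun h => hdet (by rw [h, map_zero]), ?_,
    (1 : Matrix (Fin q) (Fin q) k[X]).submatrix id g * S.adjugate *
      (1 : Matrix (Fin p) (Fin p) k[X]).submatrix f id,
    fun j i => ?_, ?_⟩
  · simpa using S.natDegree_det_le_card_mul hSdeg
  · simp only [Matrix.mul_apply, Finset.sum_mul]
    refine natDegree_sum_le_of_forall_le _ _ fun b _ =>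
      natDegree_sum_le_of_forall_le _ _ fun a _ => ?_
    simp only [Matrix.submatrix_apply, Matrix.one_apply]
    split_ifs <;> simp [S.natDegree_adjugate_le hSdeg a b]
  · have hcols : M * (1 : Matrix (Fin q) (Fin q) k[X]).submatrix id g = M.submatrix id g := by
      simpa using (Matrix.submatrix_mul_equiv M 1 id (Equiv.refl _) g)
    have hrows : (1 : Matrix (Fin p) (Fin p) k[X]).submatrix f id * M = M.submatrix f id := by
      simpa using (Matrix.submatrix_mul_equiv 1 M f (Equiv.refl _) id)
    rw [← Matrix.mul_assoc, ← Matrix.mul_assoc, hcols, Matrix.mul_assoc, hrows]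
    apply Matrix.map_injective hinj
    beta_reduce
    rw [Matrix.map_mul, Matrix.map_mul]
    refine hsplit.trans ?_
    ext i j
    simp
end

section
/- Let L be a field of characteristic zero, let n ≥ 1, let f ∈ L[x_0,…,x_n] be homogeneous of degree q ≥ 1, let m ∈ ℕ, and let b ∈ L[x_0,…,x_n] be homogeneous of degree m·q − n. Then, writing ḡ for the evaluation g|_{x_0=1} ∈ L[x_1,…,x_n], one has (f·∂_0 b − m·b·∂_0 f)|_{x_0=1} = −n·b̄·f̄ − Σ_{i=1}^n x_i·(f̄·∂_i b̄ − m·b̄·∂_i f̄). (This polynomial identity encodes (∂_0(b/f^m))|_{x_0=1} = −Σ_{i=1}^n ∂_i(x_i·(b/f^m)|_{x_0=1}), i.e., the dehomogenization of the derivative with respect to x_0 of a homogeneous rational function of degree −n is a sum of derivatives in the affine variables.) -/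
open MvPolynomial

/-- Dehomogenization: the substitution `x₀ ↦ 1`, `x_i ↦ x_{i-1}`. -/
noncomputable def dehom {L : Type*} [CommSemiring L] {n : ℕ} :
    MvPolynomial (Fin (n + 1)) L →+* MvPolynomial (Fin n) L :=
  eval₂Hom MvPolynomial.C (Fin.cases 1 fun i => X i)

section Dehomogenization

variable {L : Type*} [CommSemiring L] {n : ℕ}

@[simp]
theorem dehom_C (a : L) : dehom (C a : MvPolynomial (Fin (n + 1)) L) = C a := by
  simp [dehom]

@[simp]
theorem dehom_X_zero : dehom (X 0 : MvPolynomial (Fin (n + 1)) L) = 1 := by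
  simp [dehom]

@[simp]
theorem dehom_X_succ (i : Fin n) :
    dehom (X i.succ : MvPolynomial (Fin (n + 1)) L) = X i := by
  simp [dehom]

theorem pderiv_dehom (i : Fin n) (p : MvPolynomial (Fin (n + 1)) L) :
    pderiv i (dehom p) = dehom (pderiv i.succ p) := by
  induction p using MvPolynomial.induction_on with
  | C a => simp
  | add p q hp hq => simp [hp, hq]
  | mul_X p j hp =>
    cases j using Fin.cases with
    | zero => simp [hp, pderiv_X_of_ne (Fin.succ_ne_zero i).symm]
    | succ j =>
      rcases eq_or_ne j i with rfl | hji
      · simp [hp]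
      · simp [hp, pderiv_X_of_ne hji,
          pderiv_X_of_ne ((Fin.succ_injective n).ne hji)]

/-- Euler's identity after dehomogenization. -/
theorem MvPolynomial.IsHomogeneous.dehom_pderiv_zero_add_sum {d : ℕ}
    {p : MvPolynomial (Fin (n + 1)) L} (hp : p.IsHomogeneous d) :
    dehom (pderiv 0 p) + ∑ i : Fin n, X i * pderiv i (dehom p) = d * dehom p := by
  have h := congrArg dehom hp.sum_X_mul_pderiv
  simpa [Fin.sum_univ_succ, pderiv_dehom] using h

end Dehomogenization

/-- For `f` homogeneous of degree `q` and `b` homogeneous of degree `m·q − n`,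
the dehomogenization of `f·∂₀b − m·b·∂₀f` (the numerator of `∂₀(b/f^m)`) equals
`−n·b̄·f̄ − Σ_{i=1}^n x_i·(f̄·∂_i b̄ − m·b̄·∂_i f̄)`, i.e. `(∂₀(b/f^m))|_{x₀=1}` is a
sum of derivatives in the affine variables. -/
theorem dehom_deriv_zero_is_sum_of_derivs {L : Type*} [Field L] [CharZero L]
    (n : ℕ) (hn : 1 ≤ n) (q : ℕ) (hq : 1 ≤ q) (m : ℕ)
    (f b : MvPolynomial (Fin (n + 1)) L)
    (hf : f.IsHomogeneous q) (hbdeg : n ≤ m * q) (hb : b.IsHomogeneous (m * q - n)) :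
    dehom (f * pderiv 0 b - (m : MvPolynomial (Fin (n + 1)) L) * b * pderiv 0 f)
      = -(n : MvPolynomial (Fin n) L) * dehom b * dehom f
        - ∑ i : Fin n, X i *
            (dehom f * pderiv i (dehom b)
              - (m : MvPolynomial (Fin n) L) * dehom b * pderiv i (dehom f)) := by
  have hfe := hf.dehom_pderiv_zero_add_sum
  have hbe := hb.dehom_pderiv_zero_add_sum
  rw [Nat.cast_sub hbdeg, Nat.cast_mul] at hbe
  have hsum : ∑ i : Fin n, X i * (dehom f * pderiv i (dehom b)
        - (m : MvPolynomial (Fin n) L) * dehom b * pderiv i (dehom f))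
      = dehom f * ∑ i : Fin n, X i * pderiv i (dehom b)
        - m * dehom b * ∑ i : Fin n, X i * pderiv i (dehom f) := by
    simp only [Finset.mul_sum, ← Finset.sum_sub_distrib]
    exact Finset.sum_congr rfl fun i _ => by ring
  rw [hsum]
  simp only [map_sub, map_mul, map_natCast]
  linear_combination dehom f * hbe - m * dehom b * hfe
end

section
/- Let k be a field of characteristic zero, let n ≥ 1, and let a, f ∈ k[t][x_1,…,x_n] with f ≠ 0. Set d_pr = max(deg_x f, deg_x a + n + 1), where deg_x denotes total degree in x_1,…,x_n. Then the rational function a/f admits a telescoper with regular certificate of order at most d_pr^n: there exist r ≤ d_pr^n, polynomials c_0,…,c_r ∈ k[t] not all zero, m ∈ ℕ, and B_1,…,B_n ∈ k(t)[x_1,…,x_n] such that (Σ_{j=0}^r c_j·P_j·f^{r−j})·f^{m+1} = f^{1+r}·Σ_{i=1}^n (f·∂_i B_i − m·B_i·∂_i f), where P_0 = a and P_{j+1} = f·∂_t P_j − (1+j)·P_j·∂_t f. -/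
open MvPolynomial

section Divergence

variable {S : Type*} [CommRing S] {n : ℕ}

/-- The numerator of `∑ i, ∂_i (B i / F ^ p)` over the denominator `F ^ (p + 1)`. -/
noncomputable def divNum (F : MvPolynomial (Fin n) S) (p : ℕ) :
    (Fin n → MvPolynomial (Fin n) S) →ₗ[S] MvPolynomial (Fin n) S :=
  ∑ i, (LinearMap.mulLeft S F ∘ₗ (pderiv i).toLinearMap
    - LinearMap.mulLeft S (p * pderiv i F)) ∘ₗ LinearMap.proj i

lemma divNum_apply (F : MvPolynomial (Fin n) S) (p : ℕ) (B : Fin n → MvPolynomial (Fin n) S) :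
    divNum F p B = ∑ i, (F * pderiv i (B i) - p * B i * pderiv i F) := by
  simp only [divNum, LinearMap.sum_apply, LinearMap.comp_apply, LinearMap.sub_apply,
    LinearMap.proj_apply, LinearMap.mulLeft_apply, Derivation.coeFn_coe]
  exact Finset.sum_congr rfl fun i _ => by ring

lemma divNum_single (F : MvPolynomial (Fin n) S) (p : ℕ) (i : Fin n) (b : MvPolynomial (Fin n) S) :
    divNum F p (Pi.single i b) = F * pderiv i b - p * b * pderiv i F := by
  rw [divNum_apply, Finset.sum_eq_single i]
  · simp
  · intro j _ hj
    simp [Pi.single_eq_of_ne hj]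
  · simp

lemma pderiv_pow_mul_self (F : MvPolynomial (Fin n) S) (q : ℕ) (i : Fin n) :
    F * pderiv i (F ^ q) = q * F ^ q * pderiv i F := by
  cases q with
  | zero => simp
  | succ q =>
    simp only [Derivation.leibniz_pow, Nat.add_sub_cancel, nsmul_eq_mul, smul_eq_mul]
    ring

lemma pow_mul_divNum (F : MvPolynomial (Fin n) S) (p q : ℕ) (B : Fin n → MvPolynomial (Fin n) S) :
    F ^ q * divNum F p B = divNum F (p + q) (fun i => F ^ q * B i) := by
  simp only [divNum_apply, Finset.mul_sum, Derivation.leibniz, smul_eq_mul]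
  refine Finset.sum_congr rfl fun i _ => ?_
  push_cast
  linear_combination (-B i) * pderiv_pow_mul_self F q i

lemma pow_succ_mul_divNum (F h : MvPolynomial (Fin n) S) (p : ℕ)
    (B : Fin n → MvPolynomial (Fin n) S) :
    h ^ (p + 1) * divNum F p B = divNum (F * h) p (fun i => B i * h ^ p) := by
  simp only [divNum_apply, Finset.mul_sum, Derivation.leibniz, smul_eq_mul]
  refine Finset.sum_congr rfl fun i _ => ?_
  linear_combination (-F * B i) * pderiv_pow_mul_self h p i

lemma divNum_pow (F : MvPolynomial (Fin n) S) (p v : ℕ) (B : Fin n → MvPolynomial (Fin n) S) :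
    divNum (F ^ (v + 1)) p B = F ^ v * divNum F (p * (v + 1)) B := by
  simp only [divNum_apply, Finset.mul_sum, Derivation.leibniz_pow, smul_eq_mul, nsmul_eq_mul]
  refine Finset.sum_congr rfl fun i _ => ?_
  push_cast [Nat.add_sub_cancel]
  ring

end Divergence

section Degree

variable {R : Type*} [CommRing R] {n : ℕ}

lemma totalDegree_le_of_coeff_eq_zero {p : MvPolynomial (Fin n) R} {N : ℕ}
    (h : ∀ m : Fin n →₀ ℕ, N < m.degree → p.coeff m = 0) : p.totalDegree ≤ N := by
  refine Finset.sup_le fun m hm => ?_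
  by_contra! hlt
  exact (mem_support_iff.1 hm) (h m hlt)

lemma coeff_sum_X_mul_pderiv (f : MvPolynomial (Fin n) R) (m : Fin n →₀ ℕ) :
    (∑ i, X i * pderiv i f).coeff m = m.degree * f.coeff m := by
  induction f using MvPolynomial.induction_on' with
  | monomial u a =>
    simp only [X_mul_pderiv_monomial, coeff_sum, coeff_smul, coeff_monomial]
    split_ifs with h
    · subst h
      simp only [nsmul_eq_mul, ← Finset.sum_mul, Finsupp.degree_eq_sum, Nat.cast_sum]
    · simp
  | add p q hp hq =>
    simp only [map_add, mul_add, Finset.sum_add_distrib, coeff_add, hp, hq]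

/-- The polynomial `d f - ∑ x_i ∂_i f`, which is `∂_0` of the homogenization of `f` in degree `d`. -/
noncomputable def eulerDefect (d : ℕ) (f : MvPolynomial (Fin n) R) : MvPolynomial (Fin n) R :=
  d * f - ∑ i, X i * pderiv i f

lemma totalDegree_eulerDefect_le {f : MvPolynomial (Fin n) R} {d : ℕ} (hf : f.totalDegree ≤ d + 1) :
    (eulerDefect (d + 1) f).totalDegree ≤ d := by
  refine totalDegree_le_of_coeff_eq_zero fun m hm => ?_
  rw [eulerDefect, coeff_sub, coeff_sum_X_mul_pderiv, ← nsmul_eq_mul, coeff_smul, nsmul_eq_mul,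
    ← sub_mul]
  rcases (Nat.succ_le_of_lt hm).eq_or_lt with h | h
  · simp [← h]
  · rw [coeff_eq_zero_of_totalDegree_lt, mul_zero]
    exact lt_of_le_of_lt hf h

lemma totalDegree_pderiv_le {f : MvPolynomial (Fin n) R} {d : ℕ} (hf : f.totalDegree ≤ d + 1)
    (i : Fin n) : (pderiv i f).totalDegree ≤ d := by
  refine totalDegree_le_of_coeff_eq_zero fun m hm => ?_
  rw [coeff_pderiv, coeff_eq_zero_of_totalDegree_lt, zero_mul]
  change f.totalDegree < (m + Finsupp.single i 1).degree
  rw [map_add, Finsupp.degree_single]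
  omega

lemma pderiv_monomial_one (i : Fin n) (γ : Fin n →₀ ℕ) :
    pderiv i (monomial γ (1 : R)) = (γ i : R) • monomial (γ - Finsupp.single i 1) 1 := by
  rw [pderiv_monomial, smul_monomial]
  simp

end Degree

section TorsionFree

variable {R : Type*} [CommRing R] [IsDomain R] {n : ℕ} {Q : Type*} [AddCommGroup Q]
  [Module (Polynomial R) Q] [Module.IsTorsionFree (Polynomial R) Q]

/-- If modulo `ker ψ` multiplication by the parameter maps the polynomials of degree at most `N`
with constant coefficients into themselves, then `ψ` kills them, since the parameter is not
integral over `R`. -/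
lemma eq_zero_of_X_mul_monomial_add
    (ψ : MvPolynomial (Fin n) (Polynomial R) →ₗ[Polynomial R] Q) (N : ℕ)
    (h : ∀ α : Fin n →₀ ℕ, α.degree ≤ N → ∃ p : MvPolynomial (Fin n) R, p.totalDegree ≤ N ∧
      ψ (C Polynomial.X * monomial α 1 + map Polynomial.C p) = 0)
    {b : MvPolynomial (Fin n) R} (hb : b.totalDegree ≤ N) :
    ψ (map Polynomial.C b) = 0 := by
  let := Module.compHom Q (Polynomial.C : R →+* Polynomial R)
  have : IsScalarTower R (Polynomial R) Q := ⟨fun r s q => by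
    change (r • s) • q = (Polynomial.C r) • (s • q)
    rw [smul_smul, Polynomial.smul_eq_C_mul]⟩
  let θ : MvPolynomial (Fin n) R →ₗ[R] Q :=
    { toFun := fun p => ψ (map Polynomial.C p)
      map_add' := by simp
      map_smul' := fun r p => by
        change _ = Polynomial.C r • ψ _
        rw [smul_eq_C_mul, map_mul, map_C, ← smul_eq_C_mul, map_smul] }
  let V := (restrictTotalDegree (Fin n) R N).map θ
  have hfg : V.FG := (Module.Finite.iff_fg.1 inferInstance).map θ
  have hX : ∀ y ∈ V, (Polynomial.X : Polynomial R) • y ∈ V := by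
    rintro _ ⟨p, hp, rfl⟩
    rw [SetLike.mem_coe, mem_restrictTotalDegree] at hp
    rw [p.as_sum, map_sum, Finset.smul_sum]
    refine V.sum_mem fun α hα => ?_
    have hαN : α.degree ≤ N := (le_totalDegree hα).trans hp
    obtain ⟨q, hq, hq0⟩ := h α hαN
    have hmon : monomial α (p.coeff α) = p.coeff α • (monomial α 1 : MvPolynomial (Fin n) R) := by
      simp [smul_monomial]
    have hθ : (Polynomial.X : Polynomial R) • θ (monomial α 1) = -θ q := by
      rw [map_add, ← smul_eq_C_mul, map_smul] at hq0
      change Polynomial.X • ψ (map Polynomial.C (monomial α 1)) = _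
      rw [map_monomial, map_one]
      exact eq_neg_of_add_eq_zero_left hq0
    rw [hmon, map_smul, smul_comm, hθ]
    exact V.smul_mem _ (V.neg_mem ⟨q, by simpa [mem_restrictTotalDegree] using hq, rfl⟩)
  have hV : V = ⊥ := by
    by_contra hne
    exact Polynomial.transcendental_X R
      (isIntegral_of_smul_mem_submodule V hne hfg _ hX).isAlgebraic
  have : θ b ∈ V := ⟨b, by simpa [mem_restrictTotalDegree] using hb, rfl⟩
  rw [hV, Submodule.mem_bot] at this
  exact this

end TorsionFree

section Deformation

variable {R : Type*} [CommRing R] {n : ℕ}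

/-- The deformation of `f`, with parameter `ε = Polynomial.X`, towards `δ (1 + ∑ x_i ^ d)`. -/
noncomputable def fermatDeform (d : ℕ) (δ : R) (f : MvPolynomial (Fin n) R) :
    MvPolynomial (Fin n) (Polynomial R) :=
  map Polynomial.C f + C Polynomial.X * map Polynomial.C (C δ * (1 + ∑ i, X i ^ d))

lemma pderiv_fermat {d : ℕ} {δ : R} (hδ : ((d + 1 : ℕ) : R) * δ = 1) (i : Fin n) :
    pderiv i (C δ * (1 + ∑ j, X j ^ (d + 1)) : MvPolynomial (Fin n) R) = X i ^ d := by
  have hC : ((d + 1 : ℕ) : MvPolynomial (Fin n) R) * C δ = 1 := by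
    rw [← map_natCast C, ← C_mul, hδ, C_1]
  rw [pderiv_C_mul, map_add, pderiv_one, zero_add, map_sum, Finset.sum_eq_single i]
  · rw [Derivation.leibniz_pow, pderiv_X_self]
    simp only [Nat.add_sub_cancel, nsmul_eq_mul, smul_eq_mul, mul_one]
    linear_combination X i ^ d * hC
  · intro j _ hj
    simp [Derivation.leibniz_pow, pderiv_X_of_ne hj]
  · simp

lemma pderiv_fermatDeform {d : ℕ} {δ : R} (hδ : ((d + 1 : ℕ) : R) * δ = 1)
    (f : MvPolynomial (Fin n) R) (i : Fin n) :
    pderiv i (fermatDeform (d + 1) δ f)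
      = map Polynomial.C (pderiv i f) + C Polynomial.X * X i ^ d := by
  rw [fermatDeform, map_add, pderiv_map, pderiv_C_mul, pderiv_map, pderiv_fermat hδ]
  simp

lemma eulerDefect_fermatDeform {d : ℕ} {δ : R} (hδ : ((d + 1 : ℕ) : R) * δ = 1)
    (f : MvPolynomial (Fin n) R) :
    eulerDefect (d + 1) (fermatDeform (d + 1) δ f)
      = map Polynomial.C (eulerDefect (d + 1) f) + C Polynomial.X := by
  have hC : ((d + 1 : ℕ) : MvPolynomial (Fin n) (Polynomial R)) * C (Polynomial.C δ) = 1 := by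
    rw [← map_natCast C, ← C_mul, ← map_natCast Polynomial.C, ← Polynomial.C_mul, hδ]
    simp
  simp only [eulerDefect, pderiv_fermatDeform hδ, mul_add, Finset.sum_add_distrib]
  have hX : ∑ i : Fin n, (X i : MvPolynomial (Fin n) (Polynomial R)) *
      (C Polynomial.X * X i ^ d) = C Polynomial.X * ∑ i : Fin n, X i ^ (d + 1) := by
    rw [Finset.mul_sum]
    exact Finset.sum_congr rfl fun i _ => by ring
  rw [hX, fermatDeform]
  simp only [map_sub, map_mul, map_sum, map_add, map_pow, map_X, map_C, map_natCast, map_one]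
  linear_combination (C Polynomial.X * (1 + ∑ i : Fin n, X i ^ (d + 1))) * hC

variable [IsDomain R] [CharZero R] {Q : Type*} [AddCommGroup Q]
  [Module (Polynomial R) Q] [Module.IsTorsionFree (Polynomial R) Q]

/-- A linear map to a torsion-free module which kills divergences with poles along the deformed
polynomial, as well as the standard monomials of every pole order, kills the whole relevant part
of the pole filtration. -/
lemma eq_zero_of_standard {d : ℕ} {δ : R} (hn : 1 ≤ n) (hδ : ((d + 1 : ℕ) : R) * δ = 1)
    {f : MvPolynomial (Fin n) R} (hf : f.totalDegree ≤ d + 1) {p : ℕ}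
    (π : MvPolynomial (Fin n) (Polynomial R) →ₗ[Polynomial R] Q)
    (hdiv : ∀ B, π (divNum (fermatDeform (d + 1) δ f) p B) = 0)
    (hstd : ∀ (m q : ℕ) (α : Fin n →₀ ℕ), m + q = p + 1 → (∀ i, α i < d) →
      α.degree + n + 1 ≤ m * (d + 1) → m * (d + 1) < α.degree + n + (d + 1) →
      π (monomial α 1 * fermatDeform (d + 1) δ f ^ q) = 0)
    (m q : ℕ) (hmq : m + q = p + 1) (b : MvPolynomial (Fin n) R)
    (hb : b.totalDegree + n + 1 ≤ m * (d + 1)) :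
    π (map Polynomial.C b * fermatDeform (d + 1) δ f ^ q) = 0 := by
  set F := fermatDeform (d + 1) δ f with hF
  induction m generalizing q b with
  | zero => omega
  | succ m ih =>
    have hexact : ∀ B, π (F ^ q * divNum F m B) = 0 := fun B => by
      rw [pow_mul_divNum, show m + q = p by omega]
      exact hdiv _
    have hmono : ∀ α : Fin n →₀ ℕ, α.degree + n + 1 ≤ m * (d + 1) →
        π (monomial α 1 * F ^ (q + 1)) = 0 := fun α hα => by
      have := ih (q + 1) (by omega) (monomial α 1)
        (by have h : _ ≤ α.degree := totalDegree_monomial_le α (1 : R)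
            omega)
      rwa [map_monomial, map_one] at this
    have hpderiv : ∀ (i : Fin n) (γ : Fin n →₀ ℕ), γ.degree + n ≤ m * (d + 1) →
        π ((m : MvPolynomial (Fin n) (Polynomial R)) * (monomial γ 1 * pderiv i F * F ^ q)) = 0 :=
        fun i γ hγ => by
      have h0 : π (pderiv i (monomial γ 1) * F ^ (q + 1)) = 0 := by
        rw [pderiv_monomial_one, smul_mul_assoc, map_smul]
        rcases Nat.eq_zero_or_pos (γ i) with h | h
        · simp [h]
        · have hdeg : (γ - Finsupp.single i 1).degree + 1 = γ.degree := by
            conv_rhs => rw [← Finsupp.sub_add_single_one_cancel h.ne', map_add,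
              Finsupp.degree_single]
          rw [hmono _ (by omega), smul_zero]
      have h1 := hexact (Pi.single i (monomial γ 1))
      rw [divNum_single] at h1
      rw [← sub_eq_zero_of_eq (h0.trans h1.symm), ← map_sub]
      congr 1
      ring
    have hcancel : 0 < m → ∀ y, π ((m : MvPolynomial (Fin n) (Polynomial R)) * y) = 0 → π y = 0 :=
        fun hm y hy => by
      rw [← map_natCast C, ← smul_eq_C_mul, map_smul] at hy
      exact (smul_eq_zero.1 hy).resolve_left (by exact_mod_cast hm.ne')
    obtain ⟨N, hN⟩ : ∃ N, N + (n + 1) = m * (d + 1) + (d + 1) :=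
      ⟨m * (d + 1) + (d + 1) - (n + 1), Nat.sub_add_cancel (by rw [add_mul, one_mul] at hb; omega)⟩
    refine eq_zero_of_X_mul_monomial_add (π ∘ₗ LinearMap.mulRight (Polynomial R) (F ^ q))
      N (fun α hα => ?_) (by rw [add_mul, one_mul] at hb; omega)
    simp only [LinearMap.comp_apply, LinearMap.mulRight_apply]
    by_cases hi : ∃ i, d ≤ α i
    · obtain ⟨i, hi⟩ := hi
      obtain ⟨γ, rfl⟩ : ∃ γ, α = γ + Finsupp.single i d :=
        ⟨α - Finsupp.single i d, (tsub_add_cancel_of_le (Finsupp.single_le_iff.2 hi)).symm⟩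
      rw [map_add, Finsupp.degree_single] at hα
      have hm : 0 < m := Nat.pos_of_ne_zero fun h => by subst h; omega
      refine ⟨monomial γ 1 * pderiv i f, ?_, ?_⟩
      · have h1 := totalDegree_mul (monomial γ (1 : R)) (pderiv i f)
        have h2 : _ ≤ γ.degree := totalDegree_monomial_le γ (1 : R)
        have h3 := totalDegree_pderiv_le hf i
        omega
      · refine hcancel hm _ ?_
        have hfac : C Polynomial.X * monomial (γ + Finsupp.single i d) 1
            + map Polynomial.C (monomial γ 1 * pderiv i f) = monomial γ 1 * pderiv i F := by
          have hmul : (monomial (γ + Finsupp.single i d) 1 : MvPolynomial (Fin n) (Polynomial R))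
              = monomial γ 1 * X i ^ d := by
            rw [X_pow_eq_monomial, monomial_mul, mul_one]
          rw [hF, pderiv_fermatDeform hδ, map_mul, map_monomial, Polynomial.C_1, hmul]
          ring
        rw [hfac]
        exact hpderiv i γ (by omega)
    · push Not at hi
      by_cases hlow : (m + 1) * (d + 1) < α.degree + n + (d + 1)
      · refine ⟨0, by simp, ?_⟩
        rw [map_zero, add_zero, mul_assoc, ← smul_eq_C_mul, map_smul,
          hstd (m + 1) q α hmq hi (by rw [add_mul, one_mul]; omega) hlow, smul_zero]
      · have hdeg : α.degree + n ≤ m * (d + 1) := by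
          rw [add_mul, one_mul] at hlow
          omega
        have hm : 0 < m := Nat.pos_of_ne_zero fun h => by subst h; omega
        refine ⟨monomial α 1 * eulerDefect (d + 1) f, ?_, ?_⟩
        · have h1 := totalDegree_mul (monomial α (1 : R))
            (eulerDefect (d + 1) f)
          have h2 : _ ≤ α.degree := totalDegree_monomial_le α (1 : R)
          have h3 := totalDegree_eulerDefect_le hf
          omega
        · refine hcancel hm _ ?_
          have hfac : C Polynomial.X * monomial α 1 + map Polynomial.C
              (monomial α 1 * eulerDefect (d + 1) f)
              = monomial α 1 * eulerDefect (d + 1) F := by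
            rw [hF, eulerDefect_fermatDeform hδ, map_mul, map_monomial, Polynomial.C_1]
            ring
          have hdivX := hexact fun i => X i * monomial α 1
          rw [divNum_apply] at hdivX
          have hsum : ∑ i, pderiv i (X i * monomial α (1 : Polynomial R))
              = ((n + α.degree : ℕ) : MvPolynomial (Fin n) (Polynomial R)) * monomial α 1 := by
            simp only [Derivation.leibniz, pderiv_X_self, smul_eq_mul, X_mul_pderiv_monomial,
              Finset.sum_add_distrib, mul_one, Finset.sum_const, Finset.card_univ,
              Fintype.card_fin, nsmul_eq_mul, ← Finset.sum_mul, Finsupp.degree_eq_sum]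
            push_cast
            ring
          rw [hfac]
          have hkey : (m : MvPolynomial (Fin n) (Polynomial R)) *
              (monomial α 1 * eulerDefect (d + 1) F * F ^ q)
              = ((m * (d + 1) - (α.degree + n) : ℕ) : Polynomial R) •
                  (monomial α 1 * F ^ (q + 1))
                + F ^ q * ∑ i, (F * pderiv i (X i * monomial α (1 : Polynomial R))
                  - (m : MvPolynomial (Fin n) (Polynomial R)) * (X i * monomial α 1) * pderiv i F) := by
            have hS : ∑ i, (m : MvPolynomial (Fin n) (Polynomial R)) *
                (X i * monomial α (1 : Polynomial R))
                * pderiv i F = (m : MvPolynomial (Fin n) (Polynomial R)) *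
                  (monomial α (1 : Polynomial R) * ∑ i, X i * pderiv i F) := by
              rw [Finset.mul_sum, Finset.mul_sum]
              exact Finset.sum_congr rfl fun i _ => by ring
            rw [eulerDefect, Finset.sum_sub_distrib, ← Finset.mul_sum, hsum, hS, smul_eq_C_mul, map_natCast,
              Nat.cast_sub hdeg]
            push_cast
            ring
          rw [hkey, map_add, hdivX, add_zero, map_smul]
          rcases hdeg.eq_or_lt with h | h
          · simp [h]
          · rw [hmono α (by omega), smul_zero]

end Deformation

section LinearDependence

/-- If `card ι` elements `e` span modulo `E` a submodule whose saturation contains more than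
`card ι` elements `w`, then `w` is linearly dependent modulo `E`. -/
lemma exists_sum_smul_mem_of_torsion {S A ι κ : Type*} [CommRing S] [IsDomain S] [AddCommGroup A]
    [Module S A] [Fintype ι] [Fintype κ] (hcard : Fintype.card ι < Fintype.card κ)
    (E : Submodule S A) (e : ι → A) (w : κ → A)
    (hw : ∀ j, ∃ s : S, s ≠ 0 ∧ s • w j ∈ Submodule.span S (Set.range e) ⊔ E) :
    ∃ c : κ → S, (∃ j, c j ≠ 0) ∧ ∑ j, c j • w j ∈ E := by
  classical
  choose s hs hmem using hw
  have hdep : ¬ LinearIndependent S fun j => E.mkQ (s j • w j) := fun hli => by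
    have h := linearIndependent_le_span' _ hli (Set.range fun i => E.mkQ (e i)) (by
      rintro _ ⟨j, rfl⟩
      have h1 := Submodule.mem_map_of_mem (f := E.mkQ) (hmem j)
      rw [Submodule.map_sup, Submodule.map_span, ← Set.range_comp, Submodule.mkQ_map_self,
        sup_bot_eq] at h1
      exact h1)
    rw [Cardinal.mk_fintype, Nat.cast_le] at h
    exact absurd (h.trans (Fintype.card_range_le _)) (not_le.2 hcard)
  obtain ⟨g, hg, j, hj⟩ := Fintype.not_linearIndependent_iff.1 hdep
  refine ⟨fun j => g j * s j, ⟨j, mul_ne_zero hj (hs j)⟩, ?_⟩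
  rw [← Submodule.Quotient.mk_eq_zero, ← Submodule.mkQ_apply, ← hg, map_sum]
  exact Finset.sum_congr rfl fun j _ => by simp only [mul_smul, map_smul]

/-- The pole filtration of the deformation has rank at most `(d + 1) ^ n` modulo divergences. -/
lemma exists_relation_fermatDeform {R : Type*} [CommRing R] [IsDomain R] [CharZero R] {n d : ℕ}
    {δ : R} (hn : 1 ≤ n)
    (hδ : ((d + 1 : ℕ) : R) * δ = 1) {f : MvPolynomial (Fin n) R} (hf : f.totalDegree ≤ d + 1)
    {r : ℕ} (hr : (d + 1) ^ n ≤ r) (P : ℕ → MvPolynomial (Fin n) R)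
    (hP : ∀ j, (P j).totalDegree + n + 1 ≤ (j + 1) * (d + 1)) :
    ∃ c : ℕ → Polynomial R, (∃ j ≤ r, c j ≠ 0) ∧ ∃ B,
      ∑ j ∈ Finset.range (r + 1), C (c j) * map Polynomial.C (P j) *
        fermatDeform (d + 1) δ f ^ (r - j) = divNum (fermatDeform (d + 1) δ f) r B := by
  set F := fermatDeform (d + 1) δ f with hF
  let e : (Fin n → Fin (d + 1)) → MvPolynomial (Fin n) (Polynomial R) := fun α =>
    monomial (Finsupp.equivFunOnFinite.symm fun i => (α i : ℕ)) 1 *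
      F ^ (r + 1 - (((∑ i, (α i : ℕ)) + n) / (d + 1) + 1))
  let E := LinearMap.range (divNum F r)
  let G := Submodule.span (Polynomial R) (Set.range e) ⊔ E
  let T := Submodule.torsion (Polynomial R) (MvPolynomial (Fin n) (Polynomial R) ⧸ G)
  have hG : ∀ y ∈ G, (T.mkQ ∘ₗ G.mkQ) y = 0 := fun y hy => by
    rw [LinearMap.comp_apply, Submodule.mkQ_apply G, (Submodule.Quotient.mk_eq_zero G).2 hy,
      map_zero]
  obtain ⟨c, ⟨j, hj⟩, B, hB⟩ := exists_sum_smul_mem_of_torsion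
    (κ := Fin (r + 1)) (by simpa using Nat.lt_succ_of_le hr) E e
    (fun j => map Polynomial.C (P j) * F ^ (r - j)) (fun j => by
      have h0 := eq_zero_of_standard hn hδ hf (p := r) (T.mkQ ∘ₗ G.mkQ)
        (fun B => hG _ (Submodule.mem_sup_right ⟨B, rfl⟩))
        (fun m q α hmq hα h1 h2 => hG _ (Submodule.mem_sup_left (Submodule.subset_span
          ⟨fun i => ⟨α i, (hα i).trans (Nat.lt_succ_self d)⟩, by
            have hdiv : (α.degree + n) / (d + 1) + 1 = m := by
              obtain _ | m := m
              · omega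
              · rw [Nat.div_eq_of_lt_le (k := m)]
                · rw [add_mul, one_mul] at h2
                  omega
                · omega
            have hα' : (Finsupp.equivFunOnFinite.symm fun i => α i) = α := by
              ext
              simp
            simp only [e, hα', ← Finsupp.degree_eq_sum, hdiv]
            rw [show r + 1 - m = q by omega]⟩)))
        (j + 1) (r - j) (by omega) (P j) (hP j)
      rw [LinearMap.comp_apply, Submodule.mkQ_apply, Submodule.Quotient.mk_eq_zero,
        Submodule.mem_torsion_iff] at h0
      obtain ⟨s, hs⟩ := h0
      refine ⟨s, nonZeroDivisors.coe_ne_zero s, ?_⟩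
      rw [← Submodule.Quotient.mk_eq_zero, Submodule.Quotient.mk_smul]
      exact hs)
  refine ⟨fun j => if h : j < r + 1 then c ⟨j, h⟩ else 0,
    ⟨j, Nat.le_of_lt_succ j.2, by simpa only [dif_pos j.2] using hj⟩, B, ?_⟩
  rw [hB, Finset.sum_range]
  refine Finset.sum_congr rfl fun j _ => ?_
  simp only [dif_pos j.2]
  rw [mul_assoc, ← smul_eq_C_mul]

end LinearDependence

section Specialization

variable {R : Type*} [CommRing R] {n : ℕ}

/-- The coefficient of `ε ^ v` of a polynomial in `x` over `R[ε]`. -/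
noncomputable def epsCoeff (v : ℕ) (P : MvPolynomial (Fin n) (Polynomial R)) :
    MvPolynomial (Fin n) R :=
  ∑ m ∈ P.support, monomial m ((P.coeff m).coeff v)

lemma coeff_epsCoeff (v : ℕ) (P : MvPolynomial (Fin n) (Polynomial R)) (m : Fin n →₀ ℕ) :
    (epsCoeff v P).coeff m = (P.coeff m).coeff v := by
  classical
  simp only [epsCoeff, coeff_sum, coeff_monomial, Finset.sum_ite_eq', mem_support_iff]
  split_ifs with h
  · rfl
  · rw [not_not.1 h, Polynomial.coeff_zero]

lemma map_constantCoeff_map_C (f : MvPolynomial (Fin n) R) :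
    map Polynomial.constantCoeff (map Polynomial.C f) = f := by
  ext m
  simp [coeff_map]

lemma epsCoeff_sub (v : ℕ) (P P' : MvPolynomial (Fin n) (Polynomial R)) :
    epsCoeff v (P - P') = epsCoeff v P - epsCoeff v P' := by
  ext m
  simp [coeff_epsCoeff]

lemma epsCoeff_add (v : ℕ) (P P' : MvPolynomial (Fin n) (Polynomial R)) :
    epsCoeff v (P + P') = epsCoeff v P + epsCoeff v P' := by
  ext m
  simp [coeff_epsCoeff]

lemma epsCoeff_sum {ι : Type*} (v : ℕ) (s : Finset ι)
    (P : ι → MvPolynomial (Fin n) (Polynomial R)) :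
    epsCoeff v (∑ i ∈ s, P i) = ∑ i ∈ s, epsCoeff v (P i) := by
  ext m
  simp [coeff_epsCoeff, coeff_sum]

lemma epsCoeff_map_mul (v : ℕ) (f : MvPolynomial (Fin n) R)
    (P : MvPolynomial (Fin n) (Polynomial R)) :
    epsCoeff v (map Polynomial.C f * P) = f * epsCoeff v P := by
  ext m
  simp [coeff_epsCoeff, coeff_mul, coeff_map]

lemma epsCoeff_pderiv (v : ℕ) (i : Fin n) (P : MvPolynomial (Fin n) (Polynomial R)) :
    epsCoeff v (pderiv i P) = pderiv i (epsCoeff v P) := by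
  ext m
  rw [coeff_epsCoeff, coeff_pderiv, coeff_pderiv, coeff_epsCoeff,
    show ((m i : Polynomial R) + 1) = ((m i + 1 : ℕ) : Polynomial R) by push_cast; rfl,
    Polynomial.coeff_mul_natCast]
  push_cast
  rfl

lemma epsCoeff_X_pow_succ_mul (v : ℕ) (P : MvPolynomial (Fin n) (Polynomial R)) :
    epsCoeff v (C (Polynomial.X ^ (v + 1)) * P) = 0 := by
  ext m
  rw [coeff_epsCoeff, coeff_C_mul, Polynomial.coeff_X_pow_mul']
  simp

lemma epsCoeff_X_pow_mul (v : ℕ) (P : MvPolynomial (Fin n) (Polynomial R)) :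
    epsCoeff v (C (Polynomial.X ^ v) * P) = map Polynomial.constantCoeff P := by
  ext m
  rw [coeff_epsCoeff, coeff_C_mul, Polynomial.coeff_X_pow_mul', coeff_map]
  simp

lemma epsCoeff_divNum_map (v p : ℕ) (f : MvPolynomial (Fin n) R)
    (B : Fin n → MvPolynomial (Fin n) (Polynomial R)) :
    epsCoeff v (divNum (map Polynomial.C f) p B) = divNum f p fun i => epsCoeff v (B i) := by
  simp only [divNum_apply, epsCoeff_sum, epsCoeff_sub, epsCoeff_map_mul, epsCoeff_pderiv]
  refine Finset.sum_congr rfl fun i _ => ?_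
  have h : (p : MvPolynomial (Fin n) (Polynomial R)) * B i * pderiv i (map Polynomial.C f)
      = map Polynomial.C ((p : MvPolynomial (Fin n) R) * pderiv i f) * B i := by
    rw [pderiv_map, map_mul, map_natCast]
    ring
  rw [h, epsCoeff_map_mul]
  ring

lemma epsCoeff_divNum_add_X_pow (v p : ℕ) (F G : MvPolynomial (Fin n) (Polynomial R))
    (B : Fin n → MvPolynomial (Fin n) (Polynomial R)) :
    epsCoeff v (divNum (F + C (Polynomial.X ^ (v + 1)) * G) p B) = epsCoeff v (divNum F p B) := by
  have h : divNum (F + C (Polynomial.X ^ (v + 1)) * G) p B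
      = divNum F p B + C (Polynomial.X ^ (v + 1)) * divNum G p B := by
    simp only [divNum_apply, Finset.mul_sum, ← Finset.sum_add_distrib, map_add, pderiv_C_mul]
    exact Finset.sum_congr rfl fun i _ => by ring
  rw [h, epsCoeff_add, epsCoeff_X_pow_succ_mul, add_zero]

/-- A relation modulo divergences for a deformation `f + ε g` specializes to one for `f`, even when
all its coefficients vanish at `ε = 0`. -/
lemma exists_relation_of_deform [IsDomain R] {f : MvPolynomial (Fin n) R} (hf : f ≠ 0)
    (g : MvPolynomial (Fin n) R) {r : ℕ} (P : ℕ → MvPolynomial (Fin n) R) (c : ℕ → Polynomial R)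
    (hc : ∃ j ≤ r, c j ≠ 0) (B : Fin n → MvPolynomial (Fin n) (Polynomial R))
    (h : ∑ j ∈ Finset.range (r + 1), C (c j) * map Polynomial.C (P j) *
        (map Polynomial.C f + C Polynomial.X * map Polynomial.C g) ^ (r - j)
      = divNum (map Polynomial.C f + C Polynomial.X * map Polynomial.C g) r B) :
    ∃ c' : ℕ → R, (∃ j ≤ r, c' j ≠ 0) ∧ ∃ (m : ℕ) (B' : Fin n → MvPolynomial (Fin n) R),
      (∑ j ∈ Finset.range (r + 1), C (c' j) * P j * f ^ (r - j)) * f ^ (m + 1)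
        = f ^ (1 + r) * divNum f m B' := by
  classical
  have hex : ∃ v, ∃ j ≤ r, (c j).coeff v ≠ 0 := by
    obtain ⟨j, hj, hcj⟩ := hc
    obtain ⟨v, hv⟩ := Polynomial.ext_iff.not.1 hcj |> not_forall.1
    exact ⟨v, j, hj, by simpa using hv⟩
  set v := Nat.find hex
  obtain ⟨j₀, hj₀, hcj₀⟩ := Nat.find_spec hex
  have hdvd : ∀ j, ∃ u, j ≤ r → c j = Polynomial.X ^ v * u := fun j => by
    by_cases hj : j ≤ r
    · obtain ⟨u, hu⟩ := (Polynomial.X_pow_dvd_iff (n := v)).2 fun w hw => by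
        by_contra hne
        exact Nat.find_min hex hw ⟨j, hj, hne⟩
      exact ⟨u, fun _ => hu⟩
    · exact ⟨0, fun h => absurd h hj⟩
  choose u hu using hdvd
  refine ⟨fun j => (u j).coeff 0, ⟨j₀, hj₀, ?_⟩, r * (v + 1), ?_⟩
  · have h1 : (c j₀).coeff v = (u j₀).coeff 0 := by
      rw [hu j₀ hj₀, Polynomial.coeff_X_pow_mul']
      simp
    exact fun h0 => hcj₀ (h1.trans h0)
  set f' := map Polynomial.C f with hf'
  set F := f' + C Polynomial.X * map Polynomial.C g with hF
  obtain ⟨k, hk⟩ := sub_dvd_pow_sub_pow f' (-(C Polynomial.X * map Polynomial.C g)) (v + 1)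
  rw [sub_neg_eq_add, ← hF] at hk
  have hk' : F * k = f' ^ (v + 1)
      + C (Polynomial.X ^ (v + 1)) * -(-map Polynomial.C g) ^ (v + 1) := by
    rw [← hk, neg_mul_eq_mul_neg (C Polynomial.X) (map Polynomial.C g), mul_pow, ← C_pow]
    ring
  have hF0 : map Polynomial.constantCoeff F = f := by
    rw [hF, map_add, map_mul, map_C, map_constantCoeff_map_C]
    simp
  have hk0 : map Polynomial.constantCoeff k = f ^ v := by
    have h1 := congrArg (map Polynomial.constantCoeff) hk'
    simp only [map_mul, map_add, map_pow, hF0, hf', map_constantCoeff_map_C, map_C] at h1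
    have h3 : f * map Polynomial.constantCoeff k = f * f ^ v := by
      rw [h1]
      simp [pow_succ']
    exact mul_left_cancel₀ hf h3
  have hT : ∑ j ∈ Finset.range (r + 1), C (c j) * map Polynomial.C (P j) * F ^ (r - j)
      = C (Polynomial.X ^ v) *
        ∑ j ∈ Finset.range (r + 1), C (u j) * map Polynomial.C (P j) * F ^ (r - j) := by
    rw [Finset.mul_sum]
    refine Finset.sum_congr rfl fun j hj => ?_
    rw [hu j (Nat.le_of_lt_succ (Finset.mem_range.1 hj)), C_mul]
    ring
  have hmain := congrArg (fun y => epsCoeff v (k ^ (r + 1) * y)) h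
  rw [hT, mul_left_comm, epsCoeff_X_pow_mul, pow_succ_mul_divNum, hk',
    epsCoeff_divNum_add_X_pow, hf', ← map_pow, epsCoeff_divNum_map, divNum_pow] at hmain
  have hT0 : map Polynomial.constantCoeff
      (∑ j ∈ Finset.range (r + 1), C (u j) * map Polynomial.C (P j) * F ^ (r - j))
      = ∑ j ∈ Finset.range (r + 1), C ((u j).coeff 0) * P j * f ^ (r - j) := by
    simp only [map_sum, map_mul, map_pow, map_C, hF0, map_constantCoeff_map_C,
      Polynomial.constantCoeff_apply]
  rw [map_mul, map_pow, hk0, hT0] at hmain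
  refine ⟨fun i => epsCoeff v (B i * k ^ r), mul_left_cancel₀ (pow_ne_zero v hf) ?_⟩
  beta_reduce
  rw [mul_left_comm (f ^ v) (f ^ (1 + r)), ← hmain]
  ring

end Specialization

lemma totalDegree_dtMv_le {R : Type*} [CommRing R] {n : ℕ}
    (P : MvPolynomial (Fin n) (Polynomial R)) : (dtMv P).totalDegree ≤ P.totalDegree :=
  totalDegree_finsetSum_le fun m hm =>
    (totalDegree_monomial_le m _).trans (le_totalDegree hm)

lemma totalDegree_telSeq_le {R : Type*} [CommRing R] {n d : ℕ}
    {f a : MvPolynomial (Fin n) (Polynomial R)} (hf : f.totalDegree ≤ d)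
    (ha : a.totalDegree + n + 1 ≤ d) (j : ℕ) :
    (telSeq dtMv f a 1 j).totalDegree + n + 1 ≤ (j + 1) * d := by
  induction j with
  | zero => simpa [telSeq] using ha
  | succ j ih =>
    have h1 := totalDegree_mul f (dtMv (telSeq dtMv f a 1 j))
    have h2 := totalDegree_dtMv_le (telSeq dtMv f a 1 j)
    have h3 := totalDegree_mul (((1 + j : ℕ) : MvPolynomial (Fin n) (Polynomial R)) *
      telSeq dtMv f a 1 j) (dtMv f)
    have h4 := totalDegree_mul ((1 + j : ℕ) : MvPolynomial (Fin n) (Polynomial R))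
      (telSeq dtMv f a 1 j)
    have h5 := totalDegree_dtMv_le f
    have h6 : ((1 + j : ℕ) : MvPolynomial (Fin n) (Polynomial R)).totalDegree = 0 := by
      rw [← map_natCast C, totalDegree_C]
    have h7 := totalDegree_sub (f * dtMv (telSeq dtMv f a 1 j))
      (((1 + j : ℕ) : MvPolynomial (Fin n) (Polynomial R)) * telSeq dtMv f a 1 j * dtMv f)
    rw [telSeq, add_mul (j + 1), one_mul]
    omega

/-- Affine, possibly singular case (Theorem 4): any rational function `a/f` in
`n` affine variables over `k[t]` admits a telescoper with regular certificate of
order at most `d_pr^n`, where `d_pr = max(deg_x f, deg_x a + n + 1)`. -/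
theorem telescoper_exists_affine {k : Type*} [Field k] [CharZero k]
    (n : ℕ) (hn : 1 ≤ n)
    (a f : MvPolynomial (Fin n) (Polynomial k)) (hf : f ≠ 0) :
    ∃ r ≤ (max f.totalDegree (a.totalDegree + n + 1)) ^ n,
      ∃ c : ℕ → Polynomial k, (∃ j ≤ r, c j ≠ 0) ∧
      ∃ (m : ℕ) (B : Fin n → MvPolynomial (Fin n) (RatFunc k)),
        MvPolynomial.map (algebraMap (Polynomial k) (RatFunc k))
            ((∑ j ∈ Finset.range (r + 1),
                MvPolynomial.C (c j) * telSeq dtMv f a 1 j * f ^ (r - j)) * f ^ (m + 1))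
          = (MvPolynomial.map (algebraMap (Polynomial k) (RatFunc k)) f) ^ (1 + r) *
              ∑ i : Fin n,
                (MvPolynomial.map (algebraMap (Polynomial k) (RatFunc k)) f * pderiv i (B i)
                  - (m : MvPolynomial (Fin n) (RatFunc k)) * B i *
                      pderiv i (MvPolynomial.map (algebraMap (Polynomial k) (RatFunc k)) f)) := by
  obtain ⟨d, hd⟩ : ∃ d, max f.totalDegree (a.totalDegree + n + 1) = d + 1 :=
    Nat.exists_eq_succ_of_ne_zero (by omega)
  rw [hd]
  have hfd : f.totalDegree ≤ d + 1 := hd ▸ le_max_left _ _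
  have had : a.totalDegree + n + 1 ≤ d + 1 := hd ▸ le_max_right _ _
  have hδ : ((d + 1 : ℕ) : Polynomial k) * Polynomial.C ((d + 1 : ℕ) : k)⁻¹ = 1 := by
    rw [← map_natCast Polynomial.C, ← Polynomial.C_mul,
      mul_inv_cancel₀ (Nat.cast_ne_zero.2 d.succ_ne_zero), Polynomial.C_1]
  obtain ⟨c, hc, B, hB⟩ := exists_relation_fermatDeform hn hδ hfd le_rfl (telSeq dtMv f a 1)
    (totalDegree_telSeq_le hfd had)
  obtain ⟨c', hc', m, B', hB'⟩ := exists_relation_of_deform hf _ _ c hc B hB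
  refine ⟨(d + 1) ^ n, le_rfl, c', hc', m, fun i => map (algebraMap _ _) (B' i), ?_⟩
  rw [hB', divNum_apply]
  simp only [map_mul, map_pow, map_sum, map_sub, map_natCast, pderiv_map]
end
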